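/- (Lemma 1: asymptotic estimate for the rescaled blow-up functions.) Under the blow-up setup, for all ε > 0 and ε' ∈ (0, 1/4) there exist k = k(ε, ε') > 0, an index i₀ = i₀(ε, ε') ∈ ℕ, and a constant C = C(ε, ε') > 0 such that for all i ≥ i₀ and all θ ∈ ℝ² with k ≤ |θ| ≤ δ_i ε' / r_i, one has (−4 − ε) log|θ| − C ≤ v_i(θ) ≤ (−4 + ε) log|θ| + C. -/

import Mathlib

open MeasureTheory Filter Metric

abbrev E2 := EuclideanSpace ℝ (Fin 2)

noncomputable def pd (j : Fin 2) (u : E2 → ℝ) (x : E2) : ℝ :=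
  fderiv ℝ u x (EuclideanSpace.single j 1)

noncomputable def lapl (u : E2 → ℝ) (x : E2) : ℝ :=
  pd 0 (pd 0 u) x + pd 1 (pd 1 u) x

lemma finrank_E2 : Module.finrank ℝ E2 = 2 := by simp

lemma vol_ball_real (x : E2) {a : ℝ} (ha : 0 ≤ a) : volume.real (ball x a) = Real.pi * a ^ 2 := by
  rw [Measure.real, EuclideanSpace.volume_ball_fin_two, ENNReal.toReal_mul, ENNReal.toReal_pow,
    ENNReal.toReal_ofReal ha, ENNReal.toReal_ofReal Real.pi_pos.le, mul_comm]

lemma inv_norm_aux {a : ℝ} (ha : 0 < a) (t : ℝ) (ht : t ∈ Set.Ioi (0:ℝ)) :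
    t ^ (2 - 1) • ((Set.Iio a).indicator (fun t : ℝ => t⁻¹) t) =
      (Set.Iio a).indicator (fun _ => (1:ℝ)) t := by
  have h0 : t ≠ 0 := (ne_of_gt ht)
  by_cases h : t ∈ Set.Iio a
  · simp only [Set.indicator_of_mem h]; simp [h0]
  · simp only [Set.indicator_of_notMem h]; simp

lemma integrableOn_inv_norm0 {a : ℝ} (ha : 0 < a) :
    Integrable (fun y : E2 => (Set.Iio a).indicator (fun t : ℝ => t⁻¹) ‖y‖) := by
  rw [integrable_fun_norm_addHaar (volume : Measure E2)
    (f := (Set.Iio a).indicator (fun t : ℝ => t⁻¹)), finrank_E2]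
  rw [integrableOn_congr_fun (fun t ht => inv_norm_aux ha t ht) measurableSet_Ioi]
  rw [IntegrableOn, integrable_indicator_iff measurableSet_Iio, IntegrableOn,
    Measure.restrict_restrict measurableSet_Iio]
  have : Set.Iio a ∩ Set.Ioi 0 = Set.Ioo 0 a := by ext t; simp [and_comm]
  rw [this]
  exact integrableOn_const (by simp)

lemma integral_inv_norm0 {a : ℝ} (ha : 0 < a) :
    ∫ y : E2, (Set.Iio a).indicator (fun t : ℝ => t⁻¹) ‖y‖ = 2 * Real.pi * a := by
  rw [integral_fun_norm_addHaar (volume : Measure E2)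
    ((Set.Iio a).indicator (fun t : ℝ => t⁻¹)), finrank_E2]
  rw [setIntegral_congr_fun measurableSet_Ioi (fun t ht => inv_norm_aux ha t ht)]
  rw [integral_indicator measurableSet_Iio, Measure.restrict_restrict measurableSet_Iio]
  have : Set.Iio a ∩ Set.Ioi 0 = Set.Ioo 0 a := by ext t; simp [and_comm]
  rw [this, vol_ball_real _ zero_le_one]
  simp [ha.le]
  ring

lemma ind_eq (x : E2) (a : ℝ) :
    (fun y : E2 => (Set.Iio a).indicator (fun t : ℝ => t⁻¹) ‖x - y‖) =
      (ball x a).indicator (fun y => ‖x - y‖⁻¹) := by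
  funext y
  by_cases h : ‖x - y‖ < a
  · rw [Set.indicator_of_mem (by exact h), Set.indicator_of_mem]
    rw [mem_ball, dist_eq_norm, norm_sub_rev]; exact h
  · rw [Set.indicator_of_notMem (by exact h), Set.indicator_of_notMem]
    rw [mem_ball, dist_eq_norm, norm_sub_rev]; exact h

lemma integrableOn_inv_norm (x : E2) {a : ℝ} (ha : 0 < a) :
    IntegrableOn (fun y : E2 => ‖x - y‖⁻¹) (ball x a) := by
  rw [← integrable_indicator_iff measurableSet_ball, ← ind_eq]
  exact (integrableOn_inv_norm0 ha).comp_sub_left x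

lemma integral_inv_norm (x : E2) {a : ℝ} (ha : 0 < a) :
    ∫ y in ball x a, ‖x - y‖⁻¹ = 2 * Real.pi * a := by
  rw [← integral_indicator measurableSet_ball, ← ind_eq, ← integral_inv_norm0 ha]
  exact integral_sub_left_eq_self (fun y : E2 => (Set.Iio a).indicator (fun t : ℝ => t⁻¹) ‖y‖)
    volume x

/-- the standard mass -/
lemma hasDeriv_aux (t : ℝ) : HasDerivAt (fun t : ℝ => - (1 + t ^ 2)⁻¹) (t * (2 / (1 + t ^ 2) ^ 2)) t := by
  have h : HasDerivAt (fun t : ℝ => 1 + t ^ 2) (2 * t) t := by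
    simpa using (hasDerivAt_pow 2 t).const_add 1
  have := (h.inv (by positivity)).neg
  have e : t * (2 / (1 + t ^ 2) ^ 2) = -(-(2 * t) / (1 + t ^ 2) ^ 2) := by ring
  rw [e]
  exact this

lemma tendsto_aux : Tendsto (fun t : ℝ => - (1 + t ^ 2)⁻¹) atTop (nhds 0) := by
  rw [← neg_zero]
  refine Tendsto.neg (Tendsto.inv_tendsto_atTop ?_)
  exact tendsto_atTop_add_const_left _ _ (tendsto_pow_atTop (by norm_num))

lemma integrable_std : Integrable (fun y : E2 => 2 / (1 + ‖y‖ ^ 2) ^ 2) := by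
  rw [integrable_fun_norm_addHaar (volume : Measure E2) (f := fun t : ℝ => 2 / (1 + t ^ 2) ^ 2),
    finrank_E2]
  have : (fun t : ℝ => t ^ (2 - 1) • (2 / (1 + t ^ 2) ^ 2)) =
    fun t : ℝ => t * (2 / (1 + t ^ 2) ^ 2) := by funext t; simp
  rw [this]
  exact integrableOn_Ioi_deriv_of_nonneg' (fun t _ => hasDeriv_aux t)
    (fun t ht => by have : (0:ℝ) < t := ht; positivity) tendsto_aux

lemma integral_std : ∫ y : E2, 2 / (1 + ‖y‖ ^ 2) ^ 2 = 2 * Real.pi := by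
  rw [integral_fun_norm_addHaar (volume : Measure E2) (fun t : ℝ => 2 / (1 + t ^ 2) ^ 2),
    finrank_E2]
  have : (fun t : ℝ => t ^ (2 - 1) • (2 / (1 + t ^ 2) ^ 2)) =
    fun t : ℝ => t * (2 / (1 + t ^ 2) ^ 2) := by funext t; simp
  rw [this, integral_Ioi_of_hasDerivAt_of_nonneg' (fun t _ => hasDeriv_aux t)
    (fun t ht => by have : (0:ℝ) < t := ht; positivity) tendsto_aux, vol_ball_real _ zero_le_one]
  simp

/-- Potential bound. -/
lemma integrable_pot {G : E2 → ℝ} (hc : Continuous G) (hcs : HasCompactSupport G) (x : E2) :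
    Integrable (fun y => |G y| * ‖x - y‖⁻¹) := by
  obtain ⟨K, hK⟩ := hc.bounded_above_of_compact_support hcs
  have hm : Measurable (fun y : E2 => ‖x - y‖⁻¹) := by fun_prop
  have h1 : IntegrableOn (fun y => |G y| * ‖x - y‖⁻¹) (ball x 1) := by
    refine Integrable.bdd_mul (c := K) (integrableOn_inv_norm x one_pos) ?_ ?_
    · exact (hc.abs.aestronglyMeasurable)
    · exact Eventually.of_forall (fun y => by simpa using hK y)
  have h2 : IntegrableOn (fun y => |G y| * ‖x - y‖⁻¹) (ball x 1)ᶜ := by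
    refine Integrable.mul_bdd (c := 1) (((hc.integrable_of_hasCompactSupport hcs).abs).integrableOn)
      hm.aestronglyMeasurable ?_
    refine (ae_restrict_iff' measurableSet_ball.compl).2 (Eventually.of_forall (fun y hy => ?_))
    have : 1 ≤ ‖x - y‖ := by
      rw [norm_sub_rev, ← dist_eq_norm]; simpa using hy
    rw [norm_inv, norm_norm]
    exact inv_le_one_of_one_le₀ this
  have := h1.union h2
  rwa [Set.union_compl_self, integrableOn_univ] at this

lemma pot_bound {G : E2 → ℝ} (hc : Continuous G) (hcs : HasCompactSupport G) (h0 : ∀ y, 0 ≤ G y)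
    {K a : ℝ} (hK : ∀ y, G y ≤ K) (ha : 0 < a) (x : E2) :
    ∫ y, G y * ‖x - y‖⁻¹ ≤ 2 * Real.pi * K * a + (∫ y, G y) / a := by
  have hi : Integrable (fun y => G y * ‖x - y‖⁻¹) := by
    have := integrable_pot hc hcs x
    simpa only [abs_of_nonneg (h0 _)] using this
  have hG := hc.integrable_of_hasCompactSupport hcs (μ := volume)
  rw [← integral_add_compl (measurableSet_ball (x := x) (ε := a)) hi]
  refine add_le_add ?_ ?_
  · calc ∫ y in ball x a, G y * ‖x - y‖⁻¹ ≤ ∫ y in ball x a, K * ‖x - y‖⁻¹ := by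
          refine setIntegral_mono_on hi.integrableOn
            ((integrableOn_inv_norm x ha).const_mul K) measurableSet_ball (fun y _ => ?_)
          exact mul_le_mul_of_nonneg_right (hK y) (by positivity)
      _ = 2 * Real.pi * K * a := by
          rw [integral_const_mul, integral_inv_norm x ha]; ring
  · calc ∫ y in (ball x a)ᶜ, G y * ‖x - y‖⁻¹ ≤ ∫ y in (ball x a)ᶜ, G y * a⁻¹ := by
          refine setIntegral_mono_on hi.integrableOn (hG.mul_const _).integrableOn
            measurableSet_ball.compl (fun y hy => ?_)
          refine mul_le_mul_of_nonneg_left ?_ (h0 y)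
          have : a ≤ ‖x - y‖ := by
            rw [norm_sub_rev, ← dist_eq_norm]; simpa using hy
          exact inv_anti₀ ha this
      _ ≤ ∫ y, G y * a⁻¹ := setIntegral_le_integral (hG.mul_const _)
          (Eventually.of_forall (fun y => mul_nonneg (h0 y) (by positivity)))
      _ = (∫ y, G y) / a := by rw [integral_mul_const]; rfl

/-- Approximate identity. -/
lemma tendsto_approx {h : E2 → ℝ} (hc : Continuous h) (hcs : HasCompactSupport h) (x : E2) :
    Tendsto (fun e : ℝ => ∫ y, h y * (2 * e ^ 2 / (‖y - x‖ ^ 2 + e ^ 2) ^ 2)) (nhdsWithin 0 (Set.Ioi 0))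
      (nhds (2 * Real.pi * h x)) := by
  obtain ⟨K, hK⟩ := hc.bounded_above_of_compact_support hcs
  have key : ∀ e : ℝ, 0 < e → ∫ y, h y * (2 * e ^ 2 / (‖y - x‖ ^ 2 + e ^ 2) ^ 2) =
      ∫ z, h (x + e • z) * (2 / (1 + ‖z‖ ^ 2) ^ 2) := by
    intro e he
    rw [← integral_add_left_eq_self _ x]
    have := Measure.integral_comp_smul (volume : Measure E2)
      (fun y => h (x + y) * (2 * e ^ 2 / (‖x + y - x‖ ^ 2 + e ^ 2) ^ 2)) e
    rw [finrank_E2] at this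
    have h2 : (e ^ 2 : ℝ) ≠ 0 := by positivity
    rw [abs_of_pos (by positivity), smul_eq_mul, eq_inv_mul_iff_mul_eq₀ h2] at this
    rw [← this, ← integral_const_mul]
    congr 1
    funext z
    rw [add_sub_cancel_left, norm_smul, Real.norm_of_nonneg he.le]
    field_simp
    ring
  have hlim : Tendsto (fun e : ℝ => ∫ z, h (x + e • z) * (2 / (1 + ‖z‖ ^ 2) ^ 2))
      (nhdsWithin 0 (Set.Ioi 0)) (nhds (∫ z : E2, h x * (2 / (1 + ‖z‖ ^ 2) ^ 2))) := by
    refine tendsto_integral_filter_of_dominated_convergence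
      (fun z => K * (2 / (1 + ‖z‖ ^ 2) ^ 2)) ?_ ?_ (integrable_std.const_mul K) ?_
    · refine Eventually.of_forall (fun e => Measurable.aestronglyMeasurable ?_)
      exact (hc.comp (by fun_prop)).measurable.mul (by fun_prop)
    · refine Eventually.of_forall (fun e => Eventually.of_forall (fun z => ?_))
      rw [norm_mul, Real.norm_of_nonneg (by positivity : (0:ℝ) ≤ 2 / (1 + ‖z‖ ^ 2) ^ 2)]
      exact mul_le_mul_of_nonneg_right (hK _) (by positivity)
    · refine Eventually.of_forall (fun z => Tendsto.mul_const _ ?_)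
      have : Continuous (fun e : ℝ => h (x + e • z)) := hc.comp (by fun_prop)
      have := (this.tendsto 0).mono_left (nhdsWithin_le_nhds (s := Set.Ioi 0))
      simpa using this
  rw [integral_const_mul, integral_std] at hlim
  rw [mul_comm (2 * Real.pi)]
  refine hlim.congr' ?_
  filter_upwards [self_mem_nhdsWithin] with e he
  exact (key e he).symm

/-- integration by parts -/
lemma ibp {f g : E2 → ℝ} (hf : ContDiff ℝ 1 f) (hg : ContDiff ℝ 1 g) (hcs : HasCompactSupport g)
    (v : E2) : ∫ x, f x * fderiv ℝ g x v = - ∫ x, fderiv ℝ f x v * g x := by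
  have hf' : Continuous (fun x => fderiv ℝ f x v) :=
    (hf.continuous_fderiv (by norm_num)).clm_apply continuous_const
  have hg' : Continuous (fun x => fderiv ℝ g x v) :=
    (hg.continuous_fderiv (by norm_num)).clm_apply continuous_const
  have hgs : HasCompactSupport (fun x => fderiv ℝ g x v) := hcs.fderiv_apply ℝ v
  refine integral_mul_fderiv_eq_neg_fderiv_mul_of_integrable ?_ ?_ ?_ ?_ ?_
  · exact (hf'.mul hg.continuous).integrable_of_hasCompactSupport hcs.mul_left
  · exact (hf.continuous.mul hg').integrable_of_hasCompactSupport hgs.mul_left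
  · exact (hf.continuous.mul hg.continuous).integrable_of_hasCompactSupport hcs.mul_left
  · exact fun x _ => (hf.differentiable (by norm_num)) x
  · exact fun x _ => (hg.differentiable (by norm_num)) x
noncomputable def Nk (e : ℝ) (x : E2) (j : Fin 2) (y : E2) : ℝ := (y j - x j) / (‖y - x‖ ^ 2 + e ^ 2)

lemma contDiff_Nk {e : ℝ} (he : 0 < e) (x : E2) (j : Fin 2) : ContDiff ℝ 2 (Nk e x j) := by
  unfold Nk
  refine ContDiff.div ?_ ?_ (fun y => by positivity)
  · exact ((EuclideanSpace.proj (𝕜 := ℝ) j).contDiff).sub contDiff_const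
  · exact ((contDiff_id.sub contDiff_const).norm_sq ℝ).add contDiff_const

lemma pd_Nk {e : ℝ} (he : 0 < e) (x : E2) (i j : Fin 2) (y : E2) :
    pd i (Nk e x j) y = (if i = j then 1 else 0) / (‖y - x‖ ^ 2 + e ^ 2)
      - 2 * (y i - x i) * (y j - x j) / (‖y - x‖ ^ 2 + e ^ 2) ^ 2 := by
  have hq : ‖y - x‖ ^ 2 + e ^ 2 ≠ 0 := by positivity
  have h1 : HasFDerivAt (fun y : E2 => y j - x j) (EuclideanSpace.proj (𝕜 := ℝ) j : E2 →L[ℝ] ℝ) y :=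
    ((EuclideanSpace.proj (𝕜 := ℝ) j : E2 →L[ℝ] ℝ).hasFDerivAt).sub_const (x j)
  have h2 := (((hasFDerivAt_id (𝕜 := ℝ) y).sub_const x).norm_sq).add_const (e ^ 2)
  have h3 := h1.mul ((hasDerivAt_inv hq).comp_hasFDerivAt y h2)
  have h4 : pd i (Nk e x j) y = _ := congrArg (fun L : E2 →L[ℝ] ℝ => L (EuclideanSpace.single i 1)) h3.fderiv
  rw [h4]
  simp [EuclideanSpace.inner_single_right]
  simp only [eq_comm (a := j)]
  split_ifs
  · field_simp
    ring
  · field_simp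
    ring

lemma pd_add {f g : E2 → ℝ} (hf : ContDiff ℝ 1 f) (hg : ContDiff ℝ 1 g) (i : Fin 2) (y : E2) :
    pd i (fun y => f y + g y) y = pd i f y + pd i g y := by
  unfold pd
  rw [fderiv_fun_add ((hf.differentiable (by norm_num)) y) ((hg.differentiable (by norm_num)) y)]
  rfl

lemma pd_sub {f g : E2 → ℝ} (hf : ContDiff ℝ 1 f) (hg : ContDiff ℝ 1 g) (i : Fin 2) (y : E2) :
    pd i (fun y => f y - g y) y = pd i f y - pd i g y := by
  unfold pd
  rw [fderiv_fun_sub ((hf.differentiable (by norm_num)) y) ((hg.differentiable (by norm_num)) y)]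
  rfl

lemma pd_mul {f g : E2 → ℝ} (hf : ContDiff ℝ 1 f) (hg : ContDiff ℝ 1 g) (i : Fin 2) (y : E2) :
    pd i (fun y => f y * g y) y = pd i f y * g y + f y * pd i g y := by
  unfold pd
  rw [fderiv_fun_mul ((hf.differentiable (by norm_num)) y) ((hg.differentiable (by norm_num)) y)]
  simp
  ring

lemma contDiff_pd {f : E2 → ℝ} (hf : ContDiff ℝ 2 f) (i : Fin 2) : ContDiff ℝ 1 (pd i f) := by
  unfold pd
  exact (hf.fderiv_right (m := 1) (by norm_num)).clm_apply contDiff_const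

lemma continuous_pd {f : E2 → ℝ} (hf : ContDiff ℝ 1 f) (i : Fin 2) : Continuous (pd i f) := by
  unfold pd
  exact (hf.continuous_fderiv (by norm_num)).clm_apply continuous_const

lemma pd_comm {f : E2 → ℝ} (hf : ContDiff ℝ 2 f) (i j : Fin 2) (y : E2) :
    pd i (pd j f) y = pd j (pd i f) y := by
  have hd : DifferentiableAt ℝ (fderiv ℝ f) y :=
    ((hf.fderiv_right (m := 1) (by norm_num)).differentiable (by norm_num)) y
  have key : ∀ i j : Fin 2, pd i (pd j f) y =
      fderiv ℝ (fderiv ℝ f) y (EuclideanSpace.single i 1) (EuclideanSpace.single j 1) := by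
    intro i j
    unfold pd
    rw [fderiv_clm_apply hd (differentiableAt_const _)]
    simp
  rw [key, key]
  exact (hf.contDiffAt.isSymmSndFDerivAt (by simp)).eq _ _

lemma ibp_pd {f g : E2 → ℝ} (hf : ContDiff ℝ 1 f) (hg : ContDiff ℝ 1 g) (hcs : HasCompactSupport g)
    (i : Fin 2) : ∫ x, f x * pd i g x = - ∫ x, pd i f x * g x := ibp hf hg hcs _

lemma hcs_pd {f : E2 → ℝ} (hf : HasCompactSupport f) (i : Fin 2) : HasCompactSupport (pd i f) :=
  hf.fderiv_apply ℝ _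

lemma int_six {a b c d e f : E2 → ℝ} (ha : Integrable a) (hb : Integrable b) (hc : Integrable c)
    (hd : Integrable d) (he : Integrable e) (hf : Integrable f) :
    ∫ y, ((a y + b y) + (c y - d y)) - (e y + f y) =
      (((∫ y, a y) + ∫ y, b y) + ((∫ y, c y) - ∫ y, d y)) - ((∫ y, e y) + ∫ y, f y) := by
  have h1 : Integrable (fun y => a y + b y) := ha.add hb
  have h2 : Integrable (fun y => c y - d y) := hc.sub hd
  have h3 : Integrable (fun y => e y + f y) := he.add hf
  have h4 : Integrable (fun y => (a y + b y) + (c y - d y)) := h1.add h2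
  rw [integral_sub h4 h3, integral_add h1 h2, integral_add ha hb, integral_sub hc hd,
    integral_add he hf]

lemma grad_eps {Z χ : E2 → ℝ} (hZ : ContDiff ℝ 2 Z) (hχ : ContDiff ℝ 2 χ) (hχs : HasCompactSupport χ)
    {e : ℝ} (he : 0 < e) (x : E2) {j k : Fin 2} (hjk : j ≠ k) :
    ∫ y, (χ y * lapl Z y) * Nk e x j y =
      - (∫ y, (χ y * pd j Z y) * (2 * e ^ 2 / (‖y - x‖ ^ 2 + e ^ 2) ^ 2))
      + ∫ y, Z y * (pd j (fun y => Nk e x k y * pd k χ y + Nk e x j y * pd j χ y) y +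
          pd k (fun y => Nk e x j y * pd k χ y - Nk e x k y * pd j χ y) y) := by
  have hN := fun i => contDiff_Nk he x i
  have hN1 := fun i => (hN i).of_le (show (1 : WithTop ℕ∞) ≤ 2 by norm_num)
  have hχ1 := hχ.of_le (show (1 : WithTop ℕ∞) ≤ 2 by norm_num)
  have hZ1 := hZ.of_le (show (1 : WithTop ℕ∞) ≤ 2 by norm_num)
  have hpχ := fun i => contDiff_pd hχ i
  have hpZ := fun i => contDiff_pd hZ i
  have hcN : ∀ i, ContDiff ℝ 1 (fun y => χ y * Nk e x i y) := fun i => hχ1.mul (hN1 i)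
  have hcNs : ∀ i, HasCompactSupport (fun y => χ y * Nk e x i y) := fun i => hχs.mul_right
  have hW1 : ContDiff ℝ 1 (fun y => Nk e x k y * pd k χ y + Nk e x j y * pd j χ y) :=
    ((hN1 k).mul (hpχ k)).add ((hN1 j).mul (hpχ j))
  have hW2 : ContDiff ℝ 1 (fun y => Nk e x j y * pd k χ y - Nk e x k y * pd j χ y) :=
    ((hN1 j).mul (hpχ k)).sub ((hN1 k).mul (hpχ j))
  have hW1s : HasCompactSupport (fun y => Nk e x k y * pd k χ y + Nk e x j y * pd j χ y) :=
    ((hcs_pd hχs k).mul_left).add ((hcs_pd hχs j).mul_left)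
  have hW2s : HasCompactSupport (fun y => Nk e x j y * pd k χ y - Nk e x k y * pd j χ y) :=
    ((hcs_pd hχs k).mul_left).sub ((hcs_pd hχs j).mul_left)
  have S1 := ibp_pd (hpZ j) (hcN j) (hcNs j) j
  have S2 := ibp_pd (hpZ k) (hcN j) (hcNs j) k
  have S3 := ibp_pd (hpZ j) (hcN k) (hcNs k) k
  have S4 := ibp_pd (hpZ k) (hcN k) (hcNs k) j
  have S5 := ibp_pd hZ1 hW1 hW1s j
  have S6 := ibp_pd hZ1 hW2 hW2s k
  -- integrability helper
  have I : ∀ {f g : E2 → ℝ}, Continuous f → Continuous g → HasCompactSupport g →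
      Integrable (fun y => f y * g y) := fun hf hg hs =>
    (hf.mul hg).integrable_of_hasCompactSupport hs.mul_left
  have I1 := I (hpZ j).continuous (continuous_pd (hcN j) j) (hcs_pd (hcNs j) j)
  have I2 := I (hpZ k).continuous (continuous_pd (hcN j) k) (hcs_pd (hcNs j) k)
  have I3 := I (hpZ j).continuous (continuous_pd (hcN k) k) (hcs_pd (hcNs k) k)
  have I4 := I (hpZ k).continuous (continuous_pd (hcN k) j) (hcs_pd (hcNs k) j)
  have I5 := I hZ.continuous (continuous_pd hW1 j) (hcs_pd hW1s j)
  have I6 := I hZ.continuous (continuous_pd hW2 k) (hcs_pd hW2s k)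
  have I7 := I (hpZ j).continuous hW1.continuous hW1s
  have I8 := I (hpZ k).continuous hW2.continuous hW2s
  have I9 := I (continuous_pd (hpZ j) j) (hcN j).continuous (hcNs j)
  have I10 := I (continuous_pd (hpZ k) k) (hcN j).continuous (hcNs j)
  have sym : ∫ y, pd k (pd j Z) y * (χ y * Nk e x k y) = ∫ y, pd j (pd k Z) y * (χ y * Nk e x k y) := by
    congr 1; funext y; rw [pd_comm hZ k j]
  have hlap : ∫ y, (χ y * lapl Z y) * Nk e x j y =
      (∫ y, pd j (pd j Z) y * (χ y * Nk e x j y)) + ∫ y, pd k (pd k Z) y * (χ y * Nk e x j y) := by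
    rw [← integral_add I9 I10]
    congr 1; funext y
    have : lapl Z y = pd j (pd j Z) y + pd k (pd k Z) y := by
      unfold lapl
      fin_cases j <;> fin_cases k <;> first | exact absurd rfl hjk | simp [add_comm]
    rw [this]; ring
  have hsq : ∀ y : E2, ‖y - x‖ ^ 2 = (y j - x j) ^ 2 + (y k - x k) ^ 2 := by
    intro y
    rw [EuclideanSpace.norm_sq_eq]
    fin_cases j <;> fin_cases k <;> first | exact absurd rfl hjk | simp [add_comm]
  have hD : (fun y => (χ y * pd j Z y) * (2 * e ^ 2 / (‖y - x‖ ^ 2 + e ^ 2) ^ 2)) = fun y =>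
      ((pd j Z y * pd j (fun y => χ y * Nk e x j y) y + pd k Z y * pd k (fun y => χ y * Nk e x j y) y)
      + (pd j Z y * pd k (fun y => χ y * Nk e x k y) y - pd k Z y * pd j (fun y => χ y * Nk e x k y) y))
      - (pd j Z y * (Nk e x k y * pd k χ y + Nk e x j y * pd j χ y)
        + pd k Z y * (Nk e x j y * pd k χ y - Nk e x k y * pd j χ y)) := by
    funext y
    simp only [pd_mul hχ1 (hN1 _)]
    rw [pd_Nk he, pd_Nk he, pd_Nk he, pd_Nk he, if_pos rfl, if_pos rfl, if_neg hjk, if_neg hjk.symm]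
    have hq : ‖y - x‖ ^ 2 + e ^ 2 ≠ 0 := by positivity
    have h2 : 2 * e ^ 2 / (‖y - x‖ ^ 2 + e ^ 2) ^ 2 =
      (1 / (‖y - x‖ ^ 2 + e ^ 2) - 2 * (y j - x j) * (y j - x j) / (‖y - x‖ ^ 2 + e ^ 2) ^ 2) +
      (1 / (‖y - x‖ ^ 2 + e ^ 2) - 2 * (y k - x k) * (y k - x k) / (‖y - x‖ ^ 2 + e ^ 2) ^ 2) := by
      field_simp
      rw [hsq y]; ring
    rw [h2]
    ring
  rw [hlap, hD, int_six I1 I2 I3 I4 I7 I8]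
  have hs : ∫ y, Z y * (pd j (fun y => Nk e x k y * pd k χ y + Nk e x j y * pd j χ y) y +
          pd k (fun y => Nk e x j y * pd k χ y - Nk e x k y * pd j χ y) y) =
      (∫ y, Z y * pd j (fun y => Nk e x k y * pd k χ y + Nk e x j y * pd j χ y) y) +
      ∫ y, Z y * pd k (fun y => Nk e x j y * pd k χ y - Nk e x k y * pd j χ y) y := by
    rw [← integral_add I5 I6]
    congr 1; funext y; ring
  rw [hs]
  linarith [S1, S2, S3, S4, S5, S6, sym]
lemma abs_coord_le (z : E2) (i : Fin 2) : |z i| ≤ ‖z‖ := by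
  simpa using PiLp.norm_apply_le z i

lemma Nk_le (e : ℝ) (x : E2) (j : Fin 2) (y : E2) : |Nk e x j y| ≤ ‖x - y‖⁻¹ := by
  unfold Nk
  rw [norm_sub_rev x y, abs_div, abs_of_nonneg (by positivity : 0 ≤ ‖y - x‖ ^ 2 + e ^ 2)]
  have h := abs_coord_le (y - x) j
  simp only [PiLp.sub_apply] at h
  rcases eq_or_ne (‖y - x‖) 0 with h0 | h0
  · rw [h0] at h ⊢
    have : |y j - x j| = 0 := le_antisymm h (abs_nonneg _)
    simp [this]
  · have hp : 0 < ‖y - x‖ := lt_of_le_of_ne (norm_nonneg _) h0.symm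
    rw [div_le_iff₀ (by positivity)]
    calc |y j - x j| ≤ ‖y - x‖ := h
      _ = ‖y - x‖⁻¹ * ‖y - x‖ ^ 2 := by field_simp
      _ ≤ ‖y - x‖⁻¹ * (‖y - x‖ ^ 2 + e ^ 2) := by gcongr; nlinarith [sq_nonneg e]

lemma pdNk_le {e : ℝ} (he : 0 < e) (x : E2) (i j : Fin 2) (y : E2) {d : ℝ} (hd : 0 < d)
    (hxy : d ≤ ‖y - x‖) : |pd i (Nk e x j) y| ≤ 3 / d ^ 2 := by
  rw [pd_Nk he]
  set q := ‖y - x‖ ^ 2 + e ^ 2 with hq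
  have hqd : d ^ 2 ≤ q := by nlinarith [sq_nonneg e]
  have hq0 : 0 < q := by positivity
  have hi := abs_coord_le (y - x) i
  have hj := abs_coord_le (y - x) j
  simp only [PiLp.sub_apply] at hi hj
  have h1 : |(if i = j then (1:ℝ) else 0) / q| ≤ 1 / d ^ 2 := by
    rw [abs_div, abs_of_pos hq0]
    refine div_le_div₀ (by norm_num) ?_ (by positivity) hqd
    split_ifs <;> simp
  have h2 : |2 * (y i - x i) * (y j - x j) / q ^ 2| ≤ 2 / d ^ 2 := by
    rw [abs_div, abs_of_pos (by positivity : 0 < q ^ 2), abs_mul, abs_mul, abs_two]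
    rw [div_le_div_iff₀ (by positivity) (by positivity)]
    have h3 : |y i - x i| * |y j - x j| ≤ q := by
      calc |y i - x i| * |y j - x j| ≤ ‖y - x‖ * ‖y - x‖ :=
            mul_le_mul hi hj (abs_nonneg _) (norm_nonneg _)
        _ ≤ q := by nlinarith [sq_nonneg e]
    calc 2 * |y i - x i| * |y j - x j| * d ^ 2 = 2 * (|y i - x i| * |y j - x j|) * d ^ 2 := by ring
      _ ≤ 2 * q * q := by gcongr
      _ = 2 * q ^ 2 := by ring
  calc _ ≤ |(if i = j then (1:ℝ) else 0) / q| + |2 * (y i - x i) * (y j - x j) / q ^ 2| := abs_sub _ _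
    _ ≤ 1 / d ^ 2 + 2 / d ^ 2 := add_le_add h1 h2
    _ = 3 / d ^ 2 := by ring

lemma continuous_lapl {Z : E2 → ℝ} (hZ : ContDiff ℝ 2 Z) : Continuous (lapl Z) := by
  unfold lapl
  exact (continuous_pd (contDiff_pd hZ 0) 0).add (continuous_pd (contDiff_pd hZ 1) 1)

lemma tendsto_Nk {H : E2 → ℝ} (hc : Continuous H) (hcs : HasCompactSupport H) (x : E2) (j : Fin 2) :
    Tendsto (fun e : ℝ => ∫ y, H y * Nk e x j y) (nhdsWithin 0 (Set.Ioi 0))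
      (nhds (∫ y, H y * Nk 0 x j y)) := by
  refine tendsto_integral_filter_of_dominated_convergence (fun y => |H y| * ‖x - y‖⁻¹) ?_ ?_
    (integrable_pot hc hcs x) ?_
  · refine Eventually.of_forall (fun e => Measurable.aestronglyMeasurable ?_)
    refine hc.measurable.mul ?_
    unfold Nk
    fun_prop
  · refine Eventually.of_forall (fun e => Eventually.of_forall (fun y => ?_))
    rw [norm_mul]
    exact mul_le_mul_of_nonneg_left (Nk_le e x j y) (norm_nonneg _)
  · refine Eventually.of_forall (fun y => Tendsto.const_mul _ ?_)
    refine Tendsto.mono_left ?_ nhdsWithin_le_nhds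
    rcases eq_or_ne y x with h | h
    · have : (fun e => Nk e x j y) = fun _ => Nk 0 x j y := by
        funext e; simp [Nk, h]
      rw [this]; exact tendsto_const_nhds
    · have hn : ‖y - x‖ ^ 2 + (0:ℝ) ^ 2 ≠ 0 := by
        have : 0 < ‖y - x‖ := norm_pos_iff.2 (sub_ne_zero.2 h)
        positivity
      have : ContinuousAt (fun e : ℝ => (y j - x j) / (‖y - x‖ ^ 2 + e ^ 2)) 0 :=
        ContinuousAt.div (by fun_prop) (by fun_prop) hn
      exact this

lemma grad_rep {χ : E2 → ℝ} (hχ : ContDiff ℝ 2 χ) (hχs : HasCompactSupport χ) {α β : ℝ}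
    (hα : 1 / 4 < α) (hβ : β < 1) (h1 : ∀ y ∈ ball (0:E2) α, χ y = 1)
    (h0 : ∀ y, y ∉ closedBall (0:E2) β → χ y = 0) :
    ∃ C : ℝ, 0 ≤ C ∧ ∀ n : ℝ, 0 ≤ n → ∀ Z : E2 → ℝ, ContDiff ℝ 2 Z →
      (∀ y, α ≤ ‖y‖ → ‖y‖ ≤ β → |Z y| ≤ n) → ∀ x ∈ ball (0:E2) (1/4), ∀ ξ : E2,
      |fderiv ℝ Z x ξ + 1 / (2 * Real.pi) *
        ∫ y, (χ y * (-lapl Z y)) * (inner ℝ ξ (x - y) / ‖x - y‖ ^ 2)| ≤ C * n * ‖ξ‖ := by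
  have hχ1 := hχ.of_le (show (1 : WithTop ℕ∞) ≤ 2 by norm_num)
  have hpχ := fun i => contDiff_pd hχ i
  have hb1 : ∀ i, ∃ K, ∀ y, ‖pd i χ y‖ ≤ K := fun i =>
    (hpχ i).continuous.bounded_above_of_compact_support (hcs_pd hχs i)
  have hb2 : ∀ i k, ∃ K, ∀ y, ‖pd i (pd k χ) y‖ ≤ K := fun i k =>
    (continuous_pd (hpχ k) i).bounded_above_of_compact_support (hcs_pd (hcs_pd hχs k) i)
  choose K1 hK1 using hb1
  choose K2 hK2 using hb2
  obtain ⟨K, hK0, hK1', hK2'⟩ : ∃ K : ℝ, 0 ≤ K ∧ (∀ i y, |pd i χ y| ≤ K) ∧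
      (∀ i k y, |pd i (pd k χ) y| ≤ K) := by
    have hn1 : ∀ i, 0 ≤ K1 i := fun i => (norm_nonneg _).trans (hK1 i 0)
    have hn2 : ∀ i k, 0 ≤ K2 i k := fun i k => (norm_nonneg _).trans (hK2 i k 0)
    refine ⟨∑ i, K1 i + ∑ i, ∑ k, K2 i k, ?_, ?_, ?_⟩
    · exact add_nonneg (Finset.sum_nonneg fun i _ => hn1 i)
        (Finset.sum_nonneg fun i _ => Finset.sum_nonneg fun k _ => hn2 i k)
    · intro i y
      have := Finset.single_le_sum (fun i _ => hn1 i) (Finset.mem_univ i)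
      have h2 : 0 ≤ ∑ i, ∑ k, K2 i k :=
        Finset.sum_nonneg fun i _ => Finset.sum_nonneg fun k _ => hn2 i k
      have := hK1 i y
      rw [Real.norm_eq_abs] at this
      linarith
    · intro i k y
      have a1 := Finset.single_le_sum (fun k _ => hn2 i k) (Finset.mem_univ k)
      have a2 := Finset.single_le_sum (f := fun i => ∑ k, K2 i k)
        (fun i _ => Finset.sum_nonneg fun k _ => hn2 i k) (Finset.mem_univ i)
      have a3 : 0 ≤ ∑ i, K1 i := Finset.sum_nonneg fun i _ => hn1 i
      have := hK2 i k y
      rw [Real.norm_eq_abs] at this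
      linarith
  -- vanishing
  have hv : ∀ y : E2, ¬ (α ≤ ‖y‖ ∧ ‖y‖ ≤ β) → (∀ i, pd i χ y = 0) ∧ ∀ i k, pd i (pd k χ) y = 0 := by
    intro y hy
    have hc : ∃ c : ℝ, χ =ᶠ[nhds y] fun _ => c := by
      by_cases hα' : α ≤ ‖y‖
      · have hβ' : ¬ ‖y‖ ≤ β := fun h => hy ⟨hα', h⟩
        refine ⟨0, ?_⟩
        have : (closedBall (0:E2) β)ᶜ ∈ nhds y :=
          isClosed_closedBall.isOpen_compl.mem_nhds (by simpa using hβ')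
        filter_upwards [this] with z hz using h0 z hz
      · refine ⟨1, ?_⟩
        have : (ball (0:E2) α) ∈ nhds y := isOpen_ball.mem_nhds (by simpa using hα')
        filter_upwards [this] with z hz using h1 z hz
    obtain ⟨c, hc⟩ := hc
    have hc1 : ∀ i, pd i χ =ᶠ[nhds y] fun _ => 0 := by
      intro i
      filter_upwards [hc.eventuallyEq_nhds] with z hz
      unfold pd
      rw [hz.fderiv_eq]; simp
    refine ⟨fun i => (hc1 i).eq_of_nhds, fun i k => ?_⟩
    show fderiv ℝ (pd k χ) y _ = 0
    rw [(hc1 k).fderiv_eq]; simp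
  set d := α - 1 / 4 with hd
  have hd0 : 0 < d := by rw [hd]; linarith
  set CB := K * (12 / d ^ 2 + 4 / d) with hCB
  have hCB0 : 0 ≤ CB := by positivity
  -- coordinate version
  have coord : ∀ n : ℝ, 0 ≤ n → ∀ Z : E2 → ℝ, ContDiff ℝ 2 Z →
      (∀ y, α ≤ ‖y‖ → ‖y‖ ≤ β → |Z y| ≤ n) → ∀ x ∈ ball (0:E2) (1/4), ∀ j : Fin 2,
      |2 * Real.pi * pd j Z x + ∫ y, (χ y * lapl Z y) * Nk 0 x j y| ≤ n * CB * Real.pi := by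
    intro n hn Z hZ hZn x hx j
    obtain ⟨k, hjk⟩ : ∃ k : Fin 2, j ≠ k := by
      fin_cases j
      · exact ⟨1, by decide⟩
      · exact ⟨0, by decide⟩
    have hx' : ‖x‖ < 1 / 4 := by simpa using hx
    have hχx : χ x = 1 := h1 x (by simp; linarith)
    have hZ1 := contDiff_pd hZ j
    have T1 := tendsto_approx (h := fun y => χ y * pd j Z y) (hχ.continuous.mul hZ1.continuous)
      hχs.mul_right x
    have T2 := tendsto_Nk (H := fun y => χ y * lapl Z y) (hχ.continuous.mul (continuous_lapl hZ))
      hχs.mul_right x j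
    have T3 := (T1.add T2).abs
    simp only [hχx, one_mul] at T3
    refine le_of_tendsto T3 ?_
    filter_upwards [self_mem_nhdsWithin] with e he
    have he : 0 < e := he
    rw [grad_eps hZ hχ hχs he x hjk]
    rw [← add_assoc, add_neg_cancel, zero_add]
    have hN1 := fun i => (contDiff_Nk he x i).of_le (show (1 : WithTop ℕ∞) ≤ 2 by norm_num)
    have hB : ∀ y, |Z y * (pd j (fun y => Nk e x k y * pd k χ y + Nk e x j y * pd j χ y) y +
          pd k (fun y => Nk e x j y * pd k χ y - Nk e x k y * pd j χ y) y)| ≤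
          (ball (0:E2) 1).indicator (fun _ => n * CB) y := by
      intro y
      rw [pd_add ((hN1 k).mul (hpχ k)) ((hN1 j).mul (hpχ j)), pd_mul (hN1 k) (hpχ k),
        pd_mul (hN1 j) (hpχ j), pd_sub ((hN1 j).mul (hpχ k)) ((hN1 k).mul (hpχ j)),
        pd_mul (hN1 k) (hpχ j), pd_mul (hN1 j) (hpχ k)]
      by_cases hy : α ≤ ‖y‖ ∧ ‖y‖ ≤ β
      · rw [Set.indicator_of_mem (by simp; linarith [hy.2])]
        have hxy : d ≤ ‖y - x‖ := by
          have := norm_sub_norm_le y x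
          rw [hd]; linarith [hy.1]
        have hNb : ∀ i, |Nk e x i y| ≤ 1 / d := by
          intro i
          refine (Nk_le e x i y).trans ?_
          rw [norm_sub_rev, one_div]
          exact inv_anti₀ hd0 hxy
        have hNb' : ∀ i l, |pd i (Nk e x l) y| ≤ 3 / d ^ 2 := fun i l => pdNk_le he x i l y hd0 hxy
        have m1 : ∀ i l k, |pd i (Nk e x l) y * pd k χ y| ≤ 3 / d ^ 2 * K := fun i l k => by
          rw [abs_mul]; exact mul_le_mul (hNb' i l) (hK1' k y) (abs_nonneg _) (by positivity)
        have m2 : ∀ i l k, |Nk e x l y * pd i (pd k χ) y| ≤ 1 / d * K := fun i l k => by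
          rw [abs_mul]; exact mul_le_mul (hNb l) (hK2' i k y) (abs_nonneg _) (by positivity)
        rw [abs_mul]
        refine mul_le_mul (hZn y hy.1 hy.2) ?_ (abs_nonneg _) hn
        have e1 : CB = 4 * (3 / d ^ 2 * K) + 4 * (1 / d * K) := by rw [hCB]; ring
        rw [e1, abs_le]
        have a1 := abs_le.1 (m1 j k k)
        have a2 := abs_le.1 (m2 j k k)
        have a3 := abs_le.1 (m1 j j j)
        have a4 := abs_le.1 (m2 j j j)
        have a5 := abs_le.1 (m1 k j k)
        have a6 := abs_le.1 (m2 k j k)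
        have a7 := abs_le.1 (m1 k k j)
        have a8 := abs_le.1 (m2 k k j)
        constructor <;> linarith
      · obtain ⟨v1, v2⟩ := hv y hy
        simp only [v1, v2, mul_zero, add_zero, sub_zero, abs_zero]
        exact Set.indicator_nonneg (fun _ _ => mul_nonneg hn hCB0) y
    have hbi : Integrable ((ball (0:E2) 1).indicator (fun _ => n * CB)) := by
      rw [integrable_indicator_iff measurableSet_ball]
      exact integrableOn_const (by simp)
    rw [← Real.norm_eq_abs]
    refine (norm_integral_le_of_norm_le hbi (Eventually.of_forall (fun y => ?_))).trans ?_
    · rw [Real.norm_eq_abs]; exact hB y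
    rw [integral_indicator measurableSet_ball, setIntegral_const, vol_ball_real _ zero_le_one]
    simp only [smul_eq_mul]
    apply le_of_eq; ring
  refine ⟨CB, hCB0, fun n hn Z hZ hZn x hx ξ => ?_⟩
  have c0 := coord n hn Z hZ hZn x hx 0
  have c1 := coord n hn Z hZ hZn x hx 1
  have hξ : fderiv ℝ Z x ξ = ξ 0 * pd 0 Z x + ξ 1 * pd 1 Z x := by
    have : ξ = ξ 0 • (EuclideanSpace.single 0 (1:ℝ) : E2) + ξ 1 • EuclideanSpace.single 1 (1:ℝ) := by
      ext i; fin_cases i <;> simp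
    conv_lhs => rw [this]
    rw [map_add, map_smul, map_smul]; rfl
  have hcont : Continuous (fun y => χ y * lapl Z y) := hχ.continuous.mul (continuous_lapl hZ)
  have hcs' : HasCompactSupport (fun y => χ y * lapl Z y) := hχs.mul_right
  have hint : ∀ j, Integrable (fun y => (χ y * lapl Z y) * Nk 0 x j y) := by
    intro j
    refine (integrable_pot hcont hcs' x).mono ?_ ?_
    · refine Measurable.aestronglyMeasurable (hcont.measurable.mul ?_)
      unfold Nk; fun_prop
    · refine Eventually.of_forall (fun y => ?_)
      rw [Real.norm_eq_abs, Real.norm_eq_abs, abs_mul (χ y * lapl Z y), abs_mul |χ y * lapl Z y|, abs_abs, abs_of_nonneg (inv_nonneg.2 (norm_nonneg (x-y)))]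
      exact mul_le_mul_of_nonneg_left (Nk_le 0 x j y) (abs_nonneg _)
  have hI : ∫ y, (χ y * (-lapl Z y)) * (inner ℝ ξ (x - y) / ‖x - y‖ ^ 2) =
      ξ 0 * (∫ y, (χ y * lapl Z y) * Nk 0 x 0 y) + ξ 1 * ∫ y, (χ y * lapl Z y) * Nk 0 x 1 y := by
    rw [← integral_const_mul, ← integral_const_mul,
      ← integral_add ((hint 0).const_mul _) ((hint 1).const_mul _)]
    congr 1; funext y
    have hin : (inner ℝ ξ (x - y) : ℝ) = ξ 0 * (x 0 - y 0) + ξ 1 * (x 1 - y 1) := by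
      simp [PiLp.inner_apply, Fin.sum_univ_two, mul_comm]
    rw [hin, norm_sub_rev]
    unfold Nk
    ring
  rw [hξ, hI]
  have hpi := Real.pi_pos
  set A0 := ∫ y, (χ y * lapl Z y) * Nk 0 x 0 y
  set A1 := ∫ y, (χ y * lapl Z y) * Nk 0 x 1 y
  have e1 : ξ 0 * pd 0 Z x + ξ 1 * pd 1 Z x + 1 / (2 * Real.pi) * (ξ 0 * A0 + ξ 1 * A1) =
      1 / (2 * Real.pi) * (ξ 0 * (2 * Real.pi * pd 0 Z x + A0) + ξ 1 * (2 * Real.pi * pd 1 Z x + A1)) := by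
    field_simp
    ring
  rw [e1, abs_mul, abs_of_pos (by positivity : 0 < 1 / (2 * Real.pi))]
  have e2 : |ξ 0 * (2 * Real.pi * pd 0 Z x + A0) + ξ 1 * (2 * Real.pi * pd 1 Z x + A1)| ≤
      ‖ξ‖ * (n * CB * Real.pi) + ‖ξ‖ * (n * CB * Real.pi) := by
    refine (abs_add_le _ _).trans (add_le_add ?_ ?_)
    · rw [abs_mul]; exact mul_le_mul (abs_coord_le ξ 0) c0 (abs_nonneg _) (norm_nonneg _)
    · rw [abs_mul]; exact mul_le_mul (abs_coord_le ξ 1) c1 (abs_nonneg _) (norm_nonneg _)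
  calc _ ≤ 1 / (2 * Real.pi) * (‖ξ‖ * (n * CB * Real.pi) + ‖ξ‖ * (n * CB * Real.pi)) := by gcongr
    _ = CB * n * ‖ξ‖ := by field_simp; ring
/-- A cut-off radial vector field at scale `S`. -/
lemma exists_field : ∃ Λ : ℝ, 1 ≤ Λ ∧ ∀ S : ℝ, 0 < S → ∃ X : E2 → E2, ContDiff ℝ 1 X ∧
    HasCompactSupport X ∧ (∀ x y, ‖X x - X y‖ ≤ Λ * ‖x - y‖) ∧ (∀ x, ‖x‖ ≤ S → X x = x) ∧
    (∀ x, 2 * S ≤ ‖x‖ → X x = 0) ∧ (∀ x, ‖X x‖ ≤ 2 * S) ∧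
    (∀ x, ‖x‖ < S → ∀ j, pd j (fun z => X z j) x = 1) ∧
    (∀ x, 2 * S < ‖x‖ → ∀ j, pd j (fun z => X z j) x = 0) ∧
    (∀ x, ∀ j, |pd j (fun z => X z j) x| ≤ Λ) := by
  let φ : ContDiffBump (0:E2) := ⟨1, 2, one_pos, one_lt_two⟩
  let Y : E2 → E2 := fun x => φ x • x
  have hY : ContDiff ℝ 1 Y := φ.contDiff.smul contDiff_id
  have hYs : HasCompactSupport Y := φ.hasCompactSupport.smul_right
  obtain ⟨Λ0, hΛ0⟩ := hY.lipschitzWith_of_hasCompactSupport hYs one_ne_zero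
  set Λ : ℝ := max 1 Λ0 with hΛ
  have hYL : ∀ x y, ‖Y x - Y y‖ ≤ Λ * ‖x - y‖ := fun x y => by
    have := hΛ0.dist_le_mul x y
    rw [dist_eq_norm, dist_eq_norm] at this
    exact this.trans (mul_le_mul_of_nonneg_right (le_max_right _ _) (norm_nonneg _))
  refine ⟨Λ, le_max_left _ _, fun S hS => ?_⟩
  let X : E2 → E2 := fun x => S • Y (S⁻¹ • x)
  have hX : ContDiff ℝ 1 X := (hY.comp (contDiff_const_smul _)).const_smul S
  have hXin : ∀ x, ‖x‖ ≤ S → X x = x := by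
    intro x hx
    have : φ (S⁻¹ • x) = 1 := φ.one_of_mem_closedBall (by
      simp only [mem_closedBall, dist_zero_right, norm_smul, norm_inv, Real.norm_eq_abs, abs_of_pos hS]
      show _ ≤ (1:ℝ)
      rw [inv_mul_le_iff₀ hS]; linarith)
    simp only [X, Y, this, one_smul, smul_smul, one_mul, mul_inv_cancel₀ hS.ne', one_smul]
  have hXout : ∀ x, 2 * S ≤ ‖x‖ → X x = 0 := by
    intro x hx
    have : φ (S⁻¹ • x) = 0 := φ.zero_of_le_dist (by
      simp only [dist_zero_right, norm_smul, norm_inv, Real.norm_eq_abs, abs_of_pos hS]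
      show (2:ℝ) ≤ _
      rw [le_inv_mul_iff₀ hS]; linarith)
    simp only [X, Y, this, zero_smul, smul_zero]
  have hXL : ∀ x y, ‖X x - X y‖ ≤ Λ * ‖x - y‖ := by
    intro x y
    simp only [X]
    rw [← smul_sub, norm_smul, Real.norm_eq_abs, abs_of_pos hS]
    have := hYL (S⁻¹ • x) (S⁻¹ • y)
    rw [← smul_sub, norm_smul, norm_inv, Real.norm_eq_abs, abs_of_pos hS] at this
    calc S * _ ≤ S * (Λ * (S⁻¹ * ‖x - y‖)) := by gcongr
      _ = Λ * ‖x - y‖ := by field_simp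
  have hXj : ∀ j, ContDiff ℝ 1 (fun z => X z j) := fun j => by
    exact (contDiff_piLp_apply (p := 2) (i := j)).comp hX
  refine ⟨X, hX, ?_, hXL, hXin, hXout, ?_, ?_, ?_, ?_⟩
  · refine HasCompactSupport.intro (isCompact_closedBall (0:E2) (2 * S)) (fun x hx => hXout x ?_)
    simp at hx; exact hx.le
  · intro x
    rcases le_total (2 * S) ‖x‖ with h | h
    · rw [hXout x h]; simp; positivity
    · simp only [X, Y, smul_smul]
      rw [norm_smul, Real.norm_eq_abs]
      have h1 := φ.le_one (x := S⁻¹ • x)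
      have h2 := φ.nonneg (x := S⁻¹ • x)
      rw [abs_of_nonneg (by positivity)]
      have : S * (φ (S⁻¹ • x) * S⁻¹) = φ (S⁻¹ • x) := by field_simp
      rw [this]
      calc _ ≤ 1 * ‖x‖ := by gcongr
        _ ≤ 2 * S := by linarith
  · intro x hx j
    have : (fun z => X z j) =ᶠ[nhds x] fun z => z j := by
      have : ball (0:E2) S ∈ nhds x := isOpen_ball.mem_nhds (by simpa using hx)
      filter_upwards [this] with z hz
      rw [hXin z (by simpa using (mem_ball_zero_iff.1 hz).le)]
    unfold pd
    rw [this.fderiv_eq]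
    have h2 : HasFDerivAt (fun z : E2 => z j) (EuclideanSpace.proj j : E2 →L[ℝ] ℝ) x :=
      (EuclideanSpace.proj (𝕜 := ℝ) j).hasFDerivAt
    rw [h2.fderiv]; simp
  · intro x hx j
    have : (fun z => X z j) =ᶠ[nhds x] fun z => 0 := by
      have : (closedBall (0:E2) (2 * S))ᶜ ∈ nhds x :=
        isClosed_closedBall.isOpen_compl.mem_nhds (by simpa using hx)
      filter_upwards [this] with z hz
      rw [hXout z (by simp at hz; exact hz.le)]; rfl
    unfold pd
    rw [this.fderiv_eq]; simp
  · intro x j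
    have hL : LipschitzWith (Real.toNNReal Λ) (fun z => X z j) := by
      refine LipschitzWith.of_dist_le_mul (fun y z => ?_)
      rw [Real.coe_toNNReal _ (by positivity), dist_eq_norm, dist_eq_norm, Real.norm_eq_abs]
      exact (abs_coord_le (X y - X z) j).trans (hXL y z)
    have := norm_fderiv_le_of_lipschitz ℝ hL (x₀ := x)
    rw [Real.coe_toNNReal _ (by positivity)] at this
    unfold pd
    have h2 := (fderiv ℝ (fun z => X z j) x).le_opNorm (EuclideanSpace.single j 1)
    simp at h2
    exact h2.trans this

/-- The quantitative bubbling situation at unit scale. -/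
structure Bub (b C1 M lam τ F0 : ℝ) (Z G : E2 → ℝ) : Prop where
  lam_pos : 0 < lam
  lam_le : lam ≤ 1
  b0 : 0 ≤ b
  C0 : 0 ≤ C1
  hZ : ContDiff ℝ 1 Z
  hG : Continuous G
  hcs : HasCompactSupport G
  G0 : ∀ y, 0 ≤ G y
  Gb : ∀ y, G y ≤ b / lam ^ 2
  hM : ∫ y, G y ≤ M
  hF : ∀ x ∈ ball (0:E2) (1/4), |G x - F0 / lam ^ 2 * Real.exp (Z x - Z 0)| ≤
    τ / lam ^ 2 * Real.exp (Z x - Z 0)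
  hmax : ∀ x ∈ ball (0:E2) (1/4), Z x ≤ Z 0
  GR : ∀ x ∈ ball (0:E2) (1/4), ∀ ξ : E2, |fderiv ℝ Z x ξ + 1 / (2 * Real.pi) *
        ∫ y, G y * (inner ℝ ξ (x - y) / ‖x - y‖ ^ 2)| ≤ C1 * ‖ξ‖

namespace Bub
variable {b C1 M lam τ F0 : ℝ} {Z G : E2 → ℝ}

lemma M0 (h : Bub b C1 M lam τ F0 Z G) : 0 ≤ M :=
  (integral_nonneg h.G0).trans h.hM

lemma τ0 (h : Bub b C1 M lam τ F0 Z G) : 0 ≤ τ := by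
  have h1 := (abs_nonneg _).trans (h.hF 0 (by simp))
  have := h.lam_pos
  simp at h1
  exact (div_nonneg_iff.1 h1).elim (fun h => h.1) (fun h => absurd h.2 (not_le.2 (by positivity)))

lemma intG (h : Bub b C1 M lam τ F0 Z G) : Integrable G :=
  h.hG.integrable_of_hasCompactSupport h.hcs

lemma kern_le (ξ z : E2) : |(inner ℝ ξ z : ℝ) / ‖z‖ ^ 2| ≤ ‖ξ‖ * ‖z‖⁻¹ := by
  rw [abs_div, abs_of_nonneg (by positivity : 0 ≤ ‖z‖ ^ 2)]
  rcases eq_or_ne ‖z‖ 0 with h0 | h0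
  · simp [h0]
  · rw [div_le_iff₀ (by positivity)]
    calc _ ≤ ‖ξ‖ * ‖z‖ := abs_real_inner_le_norm ξ z
      _ = _ := by field_simp

lemma grad_bound (h : Bub b C1 M lam τ F0 Z G) {x : E2} (hx : x ∈ ball (0:E2) (1/4)) (ξ : E2) :
    |fderiv ℝ Z x ξ| ≤ (C1 + b + M) / lam * ‖ξ‖ := by
  have h1 := h.GR x hx ξ
  have hl := h.lam_pos
  have hp := pot_bound h.hG h.hcs h.G0 h.Gb hl x
  have h2 : |∫ y, G y * (inner ℝ ξ (x - y) / ‖x - y‖ ^ 2)| ≤ ‖ξ‖ * ∫ y, G y * ‖x - y‖⁻¹ := by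
    rw [← integral_const_mul, ← Real.norm_eq_abs]
    refine norm_integral_le_of_norm_le ?_ (Eventually.of_forall fun y => ?_)
    · have := (integrable_pot h.hG h.hcs x).const_mul ‖ξ‖
      simpa only [abs_of_nonneg (h.G0 _)] using this
    · rw [Real.norm_eq_abs, abs_mul, abs_of_nonneg (h.G0 y)]
      have := mul_le_mul_of_nonneg_left (kern_le ξ (x - y)) (h.G0 y)
      linarith
  set I := ∫ y, G y * (inner ℝ ξ (x - y) / ‖x - y‖ ^ 2)
  have hpi := Real.pi_gt_three
  have h3 : |1 / (2 * Real.pi) * I| ≤ (b + M) / lam * ‖ξ‖ := by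
    rw [abs_mul, abs_of_pos (by positivity : 0 < 1 / (2 * Real.pi))]
    calc 1 / (2 * Real.pi) * |I| ≤ 1 / (2 * Real.pi) * (‖ξ‖ * (2 * Real.pi * (b / lam ^ 2) * lam + M / lam)) := by
          gcongr
          refine h2.trans ?_
          gcongr
          refine hp.trans ?_
          gcongr
          exact h.hM
      _ = (b + M / (2 * Real.pi)) / lam * ‖ξ‖ := by field_simp
      _ ≤ _ := by
          have : M / (2 * Real.pi) ≤ M := div_le_self h.M0 (by linarith)
          gcongr
  have h4 : C1 * ‖ξ‖ ≤ C1 / lam * ‖ξ‖ := by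
    gcongr
    rw [le_div_iff₀ hl]
    exact mul_le_of_le_one_right h.C0 h.lam_le
  have h5 : |fderiv ℝ Z x ξ| ≤ |fderiv ℝ Z x ξ + 1 / (2 * Real.pi) * I| + |1 / (2 * Real.pi) * I| := by
    have := abs_sub (fderiv ℝ Z x ξ + 1 / (2 * Real.pi) * I) (1 / (2 * Real.pi) * I)
    simpa using this
  calc _ ≤ C1 / lam * ‖ξ‖ + (b + M) / lam * ‖ξ‖ := by linarith
    _ = _ := by ring

end Bub
lemma fderiv_coord (Z : E2 → ℝ) (x ξ : E2) :
    fderiv ℝ Z x ξ = ξ 0 * pd 0 Z x + ξ 1 * pd 1 Z x := by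
  have : ξ = ξ 0 • (EuclideanSpace.single 0 (1:ℝ) : E2) + ξ 1 • EuclideanSpace.single 1 (1:ℝ) := by
    ext i; fin_cases i <;> simp
  conv_lhs => rw [this]
  rw [map_add, map_smul, map_smul]; rfl

namespace Bub
variable {b C1 M lam τ F0 : ℝ} {Z G : E2 → ℝ}

lemma way1 (h : Bub b C1 M lam τ F0 Z G) {Λ S L : ℝ} (hΛ : 1 ≤ Λ) (hS : 0 < S) (hS2 : 2 * S < 1 / 4)
    (hL : 3 ≤ L) {X : E2 → E2} (X1 : ContDiff ℝ 1 X) (Xs : HasCompactSupport X)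
    (Xout : ∀ x, 2 * S ≤ ‖x‖ → X x = 0) (Xb : ∀ x, ‖X x‖ ≤ 2 * S)
    (Xd1 : ∀ x, ‖x‖ < S → ∀ j, pd j (fun z => X z j) x = 1)
    (Xd2 : ∀ x, 2 * S < ‖x‖ → ∀ j, pd j (fun z => X z j) x = 0)
    (Xd3 : ∀ x, ∀ j, |pd j (fun z => X z j) x| ≤ Λ) :
    |(∫ x, fderiv ℝ Z x (X x) * G x) + 2 * ∫ x in ball (0:E2) S, G x| ≤
      2 * Λ * (∫ x in ball (0:E2) (L * S) \ ball 0 S, G x) +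
      8 * Real.pi * τ * (S / lam) ^ 2 * ((C1 + b + M) * (S / lam) + Λ) := by
  have hl := h.lam_pos
  have hpi := Real.pi_pos
  have hτ := h.τ0
  have hM := h.M0
  have hb := h.b0
  have hC := h.C0
  set H : E2 → ℝ := fun x => F0 / lam ^ 2 * Real.exp (Z x - Z 0) with hH
  have hH1 : ContDiff ℝ 1 H := contDiff_const.mul ((h.hZ.sub contDiff_const).exp)
  have hXj : ∀ j, ContDiff ℝ 1 (fun z => X z j) := fun j => by
    exact (contDiff_piLp_apply (p := 2) (i := j)).comp X1
  have hXjs : ∀ j, HasCompactSupport (fun z => X z j) := fun j =>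
    Xs.comp_left (g := fun v : E2 => v j) rfl
  have hHd : ∀ x v, fderiv ℝ H x v = H x * fderiv ℝ Z x v := by
    intro x v
    have hz : HasFDerivAt Z (fderiv ℝ Z x) x := (h.hZ.differentiable (by norm_num) x).hasFDerivAt
    have := ((hz.sub_const (Z 0)).exp).const_mul (F0 / lam ^ 2)
    rw [this.fderiv]
    simp [hH]; ring
  set D : E2 → ℝ := fun x => pd 0 (fun z => X z 0) x + pd 1 (fun z => X z 1) x with hD
  have hDc : Continuous D := (continuous_pd (hXj 0) 0).add (continuous_pd (hXj 1) 1)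
  have hDs : HasCompactSupport D := (hcs_pd (hXjs 0) 0).add (hcs_pd (hXjs 1) 1)
  have hfc : Continuous (fun x => fderiv ℝ Z x (X x)) :=
    (h.hZ.continuous_fderiv (by norm_num)).clm_apply X1.continuous
  have hfs : HasCompactSupport (fun x => fderiv ℝ Z x (X x)) := by
    refine Xs.mono (fun x hx => ?_)
    simp only [Function.mem_support] at hx ⊢
    intro h0; apply hx; rw [h0]; simp
  have ic : ∀ f : E2 → ℝ, Continuous f → HasCompactSupport f → Integrable f := fun f hf hs =>
    hf.integrable_of_hasCompactSupport hs
  -- integration by parts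
  have c1 : ∫ x, fderiv ℝ Z x (X x) * H x = -∫ x, H x * D x := by
    have e0 := ibp hH1 (hXj 0) (hXjs 0) (EuclideanSpace.single 0 1)
    have e1 := ibp hH1 (hXj 1) (hXjs 1) (EuclideanSpace.single 1 1)
    have : ∫ x, H x * D x = (∫ x, H x * pd 0 (fun z => X z 0) x) + ∫ x, H x * pd 1 (fun z => X z 1) x := by
      rw [← integral_add]
      · congr 1; funext x; simp only [hD]; ring
      · exact ic _ (hH1.continuous.mul (continuous_pd (hXj 0) 0)) (hcs_pd (hXjs 0) 0).mul_left
      · exact ic _ (hH1.continuous.mul (continuous_pd (hXj 1) 1)) (hcs_pd (hXjs 1) 1).mul_left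
    rw [this]
    unfold pd
    rw [e0, e1, neg_add, neg_neg, neg_neg, ← integral_add]
    · congr 1; funext x
      rw [hHd, hHd, fderiv_coord]; unfold pd; ring
    · exact ic _ ((continuous_pd hH1 0).mul (hXj 0).continuous) (hXjs 0).mul_left
    · exact ic _ ((continuous_pd hH1 1).mul (hXj 1).continuous) (hXjs 1).mul_left
  have iFG : Integrable (fun x => fderiv ℝ Z x (X x) * G x) := ic _ (hfc.mul h.hG) hfs.mul_right
  have iFH : Integrable (fun x => fderiv ℝ Z x (X x) * H x) := ic _ (hfc.mul hH1.continuous) hfs.mul_right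
  have iGD : Integrable (fun x => G x * D x) := ic _ (h.hG.mul hDc) hDs.mul_left
  have iHD : Integrable (fun x => H x * D x) := ic _ (hH1.continuous.mul hDc) hDs.mul_left
  have hDb : ∀ x, |D x| ≤ 2 * Λ := fun x => by
    have a0 := Xd3 x 0
    have a1 := Xd3 x 1
    have := abs_add_le (pd 0 (fun z => X z 0) x) (pd 1 (fun z => X z 1) x)
    simp only [hD]; linarith
  have c2 : |(∫ x, fderiv ℝ Z x (X x) * G x) + ∫ x, G x * D x| ≤
      8 * Real.pi * τ * (S / lam) ^ 2 * ((C1 + b + M) * (S / lam) + Λ) := by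
    have e : (∫ x, fderiv ℝ Z x (X x) * G x) + ∫ x, G x * D x =
        ∫ x, (G x - H x) * (fderiv ℝ Z x (X x) + D x) := by
      have e1 : (∫ x, (fderiv ℝ Z x (X x) * H x)) + ∫ x, H x * D x = 0 := by rw [c1]; ring
      have e2 : ∫ x, (G x - H x) * (fderiv ℝ Z x (X x) + D x) =
          ((∫ x, fderiv ℝ Z x (X x) * G x) + ∫ x, G x * D x) -
          ((∫ x, (fderiv ℝ Z x (X x) * H x)) + ∫ x, H x * D x) := by
        rw [← integral_add iFG iGD, ← integral_add iFH iHD]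
        rw [← integral_sub (by exact iFG.add iGD) (by exact iFH.add iHD)]
        congr 1; funext x; ring
      rw [e2, e1, sub_zero]
    rw [e, ← Real.norm_eq_abs]
    set Q := τ / lam ^ 2 * ((C1 + b + M) / lam * (2 * S) + 2 * Λ) with hQ
    have hQ0 : 0 ≤ Q := by positivity
    have hbi : Integrable ((closedBall (0:E2) (2 * S)).indicator (fun _ => Q)) := by
      rw [integrable_indicator_iff measurableSet_closedBall]
      exact integrableOn_const (by exact measure_closedBall_lt_top.ne)
    refine (norm_integral_le_of_norm_le hbi (Eventually.of_forall (fun x => ?_))).trans ?_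
    · by_cases hx : x ∈ closedBall (0:E2) (2 * S)
      · rw [Set.indicator_of_mem hx, norm_mul, Real.norm_eq_abs, Real.norm_eq_abs]
        have hx4 : x ∈ ball (0:E2) (1/4) := by simp at hx ⊢; linarith
        have a1 : |G x - H x| ≤ τ / lam ^ 2 := by
          refine (h.hF x hx4).trans ?_
          have : Real.exp (Z x - Z 0) ≤ 1 := Real.exp_le_one_iff.2 (by linarith [h.hmax x hx4])
          exact mul_le_of_le_one_right (by positivity) this
        have a2 : |fderiv ℝ Z x (X x) + D x| ≤ (C1 + b + M) / lam * (2 * S) + 2 * Λ := by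
          refine (abs_add_le _ _).trans (add_le_add ?_ (hDb x))
          refine (h.grad_bound hx4 (X x)).trans ?_
          have := Xb x
          gcongr
        exact mul_le_mul a1 a2 (abs_nonneg _) (by positivity)
      · rw [Set.indicator_of_notMem hx]
        have hx' : 2 * S < ‖x‖ := by simpa using hx
        simp [hD, Xd2 x hx', Xout x hx'.le]
    · rw [integral_indicator measurableSet_closedBall, setIntegral_const]
      have : volume.real (closedBall (0:E2) (2 * S)) = Real.pi * (2 * S) ^ 2 := by
        rw [← vol_ball_real (0:E2) (by positivity)]
        simp only [Measure.real]
        rw [Measure.addHaar_closedBall_eq_addHaar_ball]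
      rw [this, smul_eq_mul, hQ]
      apply le_of_eq; field_simp; ring
  have c3 : |(∫ x, G x * D x) - 2 * ∫ x in ball (0:E2) S, G x| ≤
      2 * Λ * (∫ x in ball (0:E2) (L * S) \ ball 0 S, G x) := by
    have mN : MeasurableSet (ball (0:E2) (L * S) \ ball 0 S) := measurableSet_ball.diff measurableSet_ball
    rw [← integral_indicator measurableSet_ball, ← integral_indicator mN, ← integral_const_mul,
      ← integral_const_mul, ← integral_sub iGD, ← Real.norm_eq_abs]
    · refine norm_integral_le_of_norm_le ?_ (Eventually.of_forall (fun x => ?_))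
      · exact (h.intG.indicator mN).const_mul _
      · by_cases hx : x ∈ ball (0:E2) S
        · have hx' : ‖x‖ < S := by simpa using hx
          have hD2 : D x = 2 := by simp only [hD, Xd1 x hx']; norm_num
          rw [Set.indicator_of_mem hx, hD2, Set.indicator_of_notMem (by simp [hx'])]
          simp [mul_comm]
        · rw [Set.indicator_of_notMem hx, mul_zero, sub_zero]
          by_cases hx2 : x ∈ ball (0:E2) (L * S)
          · have hxN : x ∈ ball (0:E2) (L * S) \ ball 0 S := ⟨hx2, hx⟩
            rw [Set.indicator_of_mem hxN, norm_mul, Real.norm_eq_abs, Real.norm_eq_abs,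
              abs_of_nonneg (h.G0 x), mul_comm]
            exact mul_le_mul_of_nonneg_right (hDb x) (h.G0 x)
          · have hxN : x ∉ ball (0:E2) (L * S) \ ball 0 S := fun h => hx2 h.1
            rw [Set.indicator_of_notMem hxN]
            have : L * S ≤ ‖x‖ := by simpa using hx2
            have : 2 * S < ‖x‖ := by nlinarith
            simp [hD, Xd2 x this]
    · exact (h.intG.indicator measurableSet_ball).const_mul _
  calc _ = |((∫ x, fderiv ℝ Z x (X x) * G x) + ∫ x, G x * D x) -
        ((∫ x, G x * D x) - 2 * ∫ x in ball (0:E2) S, G x)| := by congr 1; ring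
    _ ≤ _ := by
      refine (abs_sub _ _).trans ?_
      linarith
end Bub
namespace Bub
variable {b C1 M lam τ F0 : ℝ} {Z G : E2 → ℝ}

lemma pot_le (h : Bub b C1 M lam τ F0 Z G) (x : E2) :
    ∫ y, G y * ‖x - y‖⁻¹ ≤ 2 * Real.pi * (b / lam ^ 2) * lam + M / lam := by
  refine (pot_bound h.hG h.hcs h.G0 h.Gb h.lam_pos x).trans ?_
  have := h.lam_pos
  gcongr
  exact h.hM

lemma integrable_pot' (h : Bub b C1 M lam τ F0 Z G) (x : E2) :
    Integrable (fun y => G y * ‖x - y‖⁻¹) := by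
  have := integrable_pot h.hG h.hcs x
  simpa only [abs_of_nonneg (h.G0 _)] using this

lemma integrable_pot2 (h : Bub b C1 M lam τ F0 Z G) :
    Integrable (fun z : E2 × E2 => G z.1 * (G z.2 * ‖z.1 - z.2‖⁻¹)) (volume.prod volume) := by
  have hm : AEStronglyMeasurable (fun z : E2 × E2 => G z.1 * (G z.2 * ‖z.1 - z.2‖⁻¹))
      ((volume : Measure E2).prod volume) := by
    refine Measurable.aestronglyMeasurable ?_
    have := h.hG.measurable
    fun_prop
  rw [integrable_prod_iff hm]
  refine ⟨Eventually.of_forall (fun x => (h.integrable_pot' x).const_mul (G x)), ?_⟩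
  refine Integrable.mono' (h.intG.mul_const (2 * Real.pi * (b / lam ^ 2) * lam + M / lam))
    hm.norm.integral_prod_right' (Eventually.of_forall (fun x => ?_))
  rw [Real.norm_eq_abs, abs_of_nonneg (integral_nonneg fun y => norm_nonneg _)]
  have : ∀ y, ‖G x * (G y * ‖x - y‖⁻¹)‖ = G x * (G y * ‖x - y‖⁻¹) := fun y => by
    rw [Real.norm_eq_abs, abs_of_nonneg]
    have := h.G0 x
    have := h.G0 y
    positivity
  simp only [this]
  rw [integral_const_mul]
  exact mul_le_mul_of_nonneg_left (h.pot_le x) (h.G0 x)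

lemma diag_null : ∀ᵐ z : E2 × E2 ∂(volume.prod volume), z.1 ≠ z.2 := by
  have hm : MeasurableSet {z : E2 × E2 | z.1 = z.2} := measurableSet_eq_fun measurable_fst measurable_snd
  have : (volume.prod volume) {z : E2 × E2 | z.1 = z.2} = 0 := by
    rw [Measure.measure_prod_null hm]
    refine Eventually.of_forall (fun x => ?_)
    have : Prod.mk x ⁻¹' {z : E2 × E2 | z.1 = z.2} = {x} := by
      ext y; simp [eq_comm]
    simp only [this, Pi.zero_apply, measure_singleton]
  rw [ae_iff]
  simpa using this

lemma way2 (h : Bub b C1 M lam τ F0 Z G) {Λ S L : ℝ} (hΛ : 1 ≤ Λ) (hS : 0 < S) (hS2 : 2 * S < 1 / 4)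
    (hL : 3 ≤ L) {X : E2 → E2} (X1 : ContDiff ℝ 1 X) (Xs : HasCompactSupport X)
    (XL : ∀ x y, ‖X x - X y‖ ≤ Λ * ‖x - y‖) (Xin : ∀ x, ‖x‖ ≤ S → X x = x)
    (Xout : ∀ x, 2 * S ≤ ‖x‖ → X x = 0) (Xb : ∀ x, ‖X x‖ ≤ 2 * S) :
    |(∫ x, fderiv ℝ Z x (X x) * G x) + 1 / (4 * Real.pi) * (∫ x in ball (0:E2) S, G x) ^ 2| ≤
      2 * C1 * S * M + 1 / (4 * Real.pi) *
      (2 * Λ * M * (∫ x in ball (0:E2) (L * S) \ ball 0 S, G x) + M ^ 2 / (L - 1)) := by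
  have hl := h.lam_pos
  have hpi := Real.pi_pos
  have hM := h.M0
  have hC := h.C0
  set W : E2 × E2 → ℝ := fun z => G z.1 * (G z.2 * (inner ℝ (X z.1) (z.1 - z.2) / ‖z.1 - z.2‖ ^ 2)) with hW
  have iW : Integrable W (volume.prod volume) := by
    refine Integrable.mono' (h.integrable_pot2.const_mul (2 * S)) ?_ (Eventually.of_forall fun z => ?_)
    · refine Measurable.aestronglyMeasurable ?_
      have := h.hG.measurable
      have := X1.continuous.measurable
      fun_prop
    · rw [hW, Real.norm_eq_abs, abs_mul, abs_mul, abs_of_nonneg (h.G0 _), abs_of_nonneg (h.G0 _)]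
      have k1 := kern_le (X z.1) (z.1 - z.2)
      have k2 := Xb z.1
      have g1 := h.G0 z.1
      have g2 := h.G0 z.2
      calc _ ≤ G z.1 * (G z.2 * (2 * S * ‖z.1 - z.2‖⁻¹)) := by
            gcongr
            exact k1.trans (by gcongr)
        _ = _ := by ring
  set I := ∫ z, W z ∂(volume.prod volume) with hI
  have hI1 : I = ∫ x, G x * ∫ y, G y * (inner ℝ (X x) (x - y) / ‖x - y‖ ^ 2) := by
    rw [hI, integral_prod _ iW]
    congr 1; funext x
    rw [← integral_const_mul]
  have iI1 : Integrable (fun x => G x * ∫ y, G y * (inner ℝ (X x) (x - y) / ‖x - y‖ ^ 2)) := by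
    have := iW.integral_prod_left
    refine this.congr (Eventually.of_forall fun x => ?_)
    simp only [hW]
    rw [← integral_const_mul]
  have iFG : Integrable (fun x => fderiv ℝ Z x (X x) * G x) := by
    refine Continuous.integrable_of_hasCompactSupport ?_ h.hcs.mul_left
    exact ((h.hZ.continuous_fderiv (by norm_num)).clm_apply X1.continuous).mul h.hG
  have c1 : |(∫ x, fderiv ℝ Z x (X x) * G x) + 1 / (2 * Real.pi) * I| ≤ 2 * C1 * S * M := by
    rw [hI1, ← integral_const_mul, ← integral_add iFG (iI1.const_mul _), ← Real.norm_eq_abs]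
    refine (norm_integral_le_of_norm_le (h.intG.mul_const (C1 * (2 * S)))
      (Eventually.of_forall (fun x => ?_))).trans ?_
    · have e : fderiv ℝ Z x (X x) * G x + 1 / (2 * Real.pi) *
          (G x * ∫ y, G y * (inner ℝ (X x) (x - y) / ‖x - y‖ ^ 2)) =
          G x * (fderiv ℝ Z x (X x) + 1 / (2 * Real.pi) *
          ∫ y, G y * (inner ℝ (X x) (x - y) / ‖x - y‖ ^ 2)) := by ring
      rw [e, norm_mul, Real.norm_eq_abs, Real.norm_eq_abs, abs_of_nonneg (h.G0 x)]
      refine mul_le_mul_of_nonneg_left ?_ (h.G0 x)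
      by_cases hx : 2 * S ≤ ‖x‖
      · rw [Xout x hx]; simp; positivity
      · refine (h.GR x (by simp; simp at hx; linarith) (X x)).trans ?_
        exact mul_le_mul_of_nonneg_left (Xb x) hC
    · rw [integral_mul_const]
      calc _ ≤ M * (C1 * (2 * S)) := by gcongr; exact h.hM
        _ = _ := by ring
  set B := ball (0:E2) S with hB
  set N := ball (0:E2) (L * S) \ B with hN
  have mB : MeasurableSet B := measurableSet_ball
  have mN : MeasurableSet N := measurableSet_ball.diff measurableSet_ball
  set GB := B.indicator G with hGB
  set GN := N.indicator G with hGN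
  have iGB : Integrable GB := h.intG.indicator mB
  have iGN : Integrable GN := h.intG.indicator mN
  have hsw : I = ∫ z, W z.swap ∂(volume.prod volume) := by
    rw [hI]; exact (integral_prod_swap W).symm
  have iWs : Integrable (fun z : E2 × E2 => W z.swap) (volume.prod volume) := iW.swap
  have h2I : 2 * I = ∫ z, (W z + W z.swap) ∂(volume.prod volume) := by
    rw [integral_add iW iWs, ← hsw, ← hI]; ring
  have hm2 : (∫ x in B, G x) ^ 2 = ∫ z : E2 × E2, GB z.1 * GB z.2 ∂(volume.prod volume) := by
    rw [integral_prod_mul, hGB, integral_indicator mB]; ring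
  have iBB : Integrable (fun z : E2 × E2 => GB z.1 * GB z.2) (volume.prod volume) := iGB.mul_prod iGB
  have hL1 : 0 < L - 1 := by linarith
  have c2 : |2 * I - (∫ x in B, G x) ^ 2| ≤ 2 * Λ * M * (∫ x in N, G x) + M ^ 2 / (L - 1) := by
    rw [h2I, hm2, ← integral_sub (by exact iW.add iWs) iBB, ← Real.norm_eq_abs]
    have i1 : Integrable (fun z : E2 × E2 => Λ * (GN z.1 * G z.2)) (volume.prod volume) :=
      (iGN.mul_prod h.intG).const_mul _
    have i2 : Integrable (fun z : E2 × E2 => Λ * (G z.1 * GN z.2)) (volume.prod volume) :=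
      (h.intG.mul_prod iGN).const_mul _
    have i3 : Integrable (fun z : E2 × E2 => (L - 1)⁻¹ * (G z.1 * G z.2)) (volume.prod volume) :=
      (h.intG.mul_prod h.intG).const_mul _
    refine (norm_integral_le_of_norm_le ((i1.add i2).add i3) ?_).trans ?_
    · filter_upwards [diag_null] with z hz
      obtain ⟨x, y⟩ := z
      simp only [ne_eq] at hz
      simp only [hW, Prod.swap, Pi.add_apply, Prod.fst_swap, Prod.snd_swap]
      have g1 := h.G0 x
      have g2 := h.G0 y
      have hxy : 0 < ‖x - y‖ := norm_pos_iff.2 (sub_ne_zero.2 hz)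
      have e1 : G x * (G y * (inner ℝ (X x) (x - y) / ‖x - y‖ ^ 2)) +
          G y * (G x * (inner ℝ (X y) (y - x) / ‖y - x‖ ^ 2)) =
          (G x * G y) * (inner ℝ (X x - X y) (x - y) / ‖x - y‖ ^ 2) := by
        rw [norm_sub_rev y x, inner_sub_left, ← neg_sub x y, inner_neg_right]; ring
      rw [e1]
      have n0 : ∀ x, 0 ≤ GN x := fun x => Set.indicator_nonneg (fun y _ => h.G0 y) x
      have q0 : 0 ≤ Λ * (GN x * G y) := by have := n0 x; positivity
      have q1 : 0 ≤ Λ * (G x * GN y) := by have := n0 y; positivity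
      have q2 : 0 ≤ (L - 1)⁻¹ * (G x * G y) := by positivity
      have kl := kern_le (X x - X y) (x - y)
      have kL : |(inner ℝ (X x - X y) (x - y) : ℝ) / ‖x - y‖ ^ 2| ≤ Λ := by
        refine kl.trans ?_
        rw [← div_eq_mul_inv, div_le_iff₀ hxy]
        exact XL x y
      set q := (inner ℝ (X x - X y) (x - y) : ℝ) / ‖x - y‖ ^ 2 with hq
      rw [Real.norm_eq_abs]
      by_cases xN : x ∈ N
      · have : GB x = 0 := Set.indicator_of_notMem xN.2 _
        have e : GN x = G x := Set.indicator_of_mem xN _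
        rw [this, zero_mul, sub_zero, abs_mul, abs_of_nonneg (by positivity : 0 ≤ G x * G y)]
        rw [e] at q0 ⊢
        have : G x * G y * |q| ≤ G x * G y * Λ := by gcongr
        linarith
      by_cases yN : y ∈ N
      · have : GB y = 0 := Set.indicator_of_notMem yN.2 _
        have e : GN y = G y := Set.indicator_of_mem yN _
        rw [this, mul_zero, sub_zero, abs_mul, abs_of_nonneg (by positivity : 0 ≤ G x * G y)]
        rw [e] at q1 ⊢
        have : G x * G y * |q| ≤ G x * G y * Λ := by gcongr
        linarith
      have key : |G x * G y * q - GB x * GB y| ≤ (L - 1)⁻¹ * (G x * G y) := by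
        have out : ∀ x, x ∉ N → x ∉ B → L * S ≤ ‖x‖ ∧ X x = 0 := by
          intro x h1 h2
          have h3 : x ∉ ball (0:E2) (L * S) := fun h => h1 ⟨h, h2⟩
          have h4 : L * S ≤ ‖x‖ := by simpa using h3
          exact ⟨h4, Xout x (by nlinarith)⟩
        have inn : ∀ x, x ∈ B → ‖x‖ < S ∧ X x = x := by
          intro x h1
          have h4 : ‖x‖ < S := by simpa [hB] using h1
          exact ⟨h4, Xin x h4.le⟩
        by_cases xB : x ∈ B
        · by_cases yB : y ∈ B
          · have ex : GB x = G x := Set.indicator_of_mem xB _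
            have ey : GB y = G y := Set.indicator_of_mem yB _
            have : q = 1 := by
              rw [hq, (inn x xB).2, (inn y yB).2, real_inner_self_eq_norm_sq, div_self (by positivity)]
            rw [ex, ey, this]; simp; positivity
          · have ey : GB y = 0 := Set.indicator_of_notMem yB _
            obtain ⟨o1, o2⟩ := out y yN yB
            obtain ⟨p1, p2⟩ := inn x xB
            rw [ey, mul_zero, sub_zero, abs_mul, abs_of_nonneg (by positivity : 0 ≤ G x * G y), mul_comm]
            refine mul_le_mul_of_nonneg_right (kl.trans ?_) (by positivity)
            rw [o2, p2, sub_zero, ← div_eq_mul_inv, div_le_iff₀ hxy, le_inv_mul_iff₀ hL1]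
            have := norm_sub_norm_le y x
            rw [norm_sub_rev] at this
            nlinarith
        · have ex : GB x = 0 := Set.indicator_of_notMem xB _
          obtain ⟨o1, o2⟩ := out x xN xB
          rw [ex, zero_mul, sub_zero, abs_mul, abs_of_nonneg (by positivity : 0 ≤ G x * G y), mul_comm]
          refine mul_le_mul_of_nonneg_right (kl.trans ?_) (by positivity)
          rw [← div_eq_mul_inv, div_le_iff₀ hxy, le_inv_mul_iff₀ hL1]
          by_cases yB : y ∈ B
          · obtain ⟨p1, p2⟩ := inn y yB
            rw [o2, p2, zero_sub, norm_neg]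
            have := norm_sub_norm_le x y
            nlinarith
          · rw [o2, (out y yN yB).2]; simp
      linarith
    · simp only [Pi.add_apply]
      rw [integral_add (by exact i1.add i2) i3, integral_add i1 i2, integral_const_mul, integral_const_mul,
        integral_const_mul, integral_prod_mul, integral_prod_mul, integral_prod_mul, hGN, integral_indicator mN]
      have n0 : 0 ≤ ∫ x in N, G x := integral_nonneg h.G0
      have hIM := h.hM
      have hI0 : 0 ≤ ∫ x, G x := integral_nonneg h.G0
      have a1 : (∫ x, G x) * (∫ x, G x) ≤ M * M := by gcongr
      have a2 : (L - 1)⁻¹ * ((∫ x, G x) * (∫ x, G x)) ≤ (L - 1)⁻¹ * (M * M) := by gcongr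
      have a3 : Λ * ((∫ x in N, G x) * ∫ x, G x) ≤ Λ * ((∫ x in N, G x) * M) := by gcongr
      have a4 : M ^ 2 / (L - 1) = (L - 1)⁻¹ * (M * M) := by ring
      rw [a4]
      linarith [mul_comm (∫ x in N, G x) (∫ x, G x)]
  have e : (∫ x, fderiv ℝ Z x (X x) * G x) + 1 / (4 * Real.pi) * (∫ x in B, G x) ^ 2 =
      ((∫ x, fderiv ℝ Z x (X x) * G x) + 1 / (2 * Real.pi) * I) -
      1 / (4 * Real.pi) * (2 * I - (∫ x in B, G x) ^ 2) := by field_simp; ring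
  rw [e]
  refine (abs_sub _ _).trans (add_le_add c1 ?_)
  rw [abs_mul, abs_of_pos (by positivity : 0 < 1 / (4 * Real.pi))]
  gcongr

end Bub

lemma pohozaev : ∃ Λ : ℝ, 1 ≤ Λ ∧ ∀ (b C1 M lam τ F0 : ℝ) (Z G : E2 → ℝ), Bub b C1 M lam τ F0 Z G →
    ∀ S L : ℝ, 0 < S → 2 * S < 1 / 4 → 3 ≤ L →
    |1 / (4 * Real.pi) * (∫ x in ball (0:E2) S, G x) ^ 2 - 2 * ∫ x in ball (0:E2) S, G x| ≤
      2 * Λ * (∫ x in ball (0:E2) (L * S) \ ball 0 S, G x) +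
      8 * Real.pi * τ * (S / lam) ^ 2 * ((C1 + b + M) * (S / lam) + Λ) +
      (2 * C1 * S * M + 1 / (4 * Real.pi) *
      (2 * Λ * M * (∫ x in ball (0:E2) (L * S) \ ball 0 S, G x) + M ^ 2 / (L - 1))) := by
  obtain ⟨Λ, hΛ, hX⟩ := exists_field
  refine ⟨Λ, hΛ, fun b C1 M lam τ F0 Z G h S L hS hS2 hL => ?_⟩
  obtain ⟨X, X1, Xs, XL, Xin, Xout, Xb, Xd1, Xd2, Xd3⟩ := hX S hS
  have w1 := h.way1 hΛ hS hS2 hL X1 Xs Xout Xb Xd1 Xd2 Xd3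
  have w2 := h.way2 hΛ hS hS2 hL X1 Xs XL Xin Xout Xb
  have e : 1 / (4 * Real.pi) * (∫ x in ball (0:E2) S, G x) ^ 2 - 2 * (∫ x in ball (0:E2) S, G x) =
     ((∫ x, fderiv ℝ Z x (X x) * G x) + 1 / (4 * Real.pi) * (∫ x in ball (0:E2) S, G x) ^ 2) -
     ((∫ x, fderiv ℝ Z x (X x) * G x) + 2 * ∫ x in ball (0:E2) S, G x) := by ring
  rw [e]
  refine (abs_sub _ _).trans ?_
  linarith
namespace Bub
variable {b C1 M lam τ F0 : ℝ} {Z G : E2 → ℝ}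

lemma mass_mono (h : Bub b C1 M lam τ F0 Z G) {s t : ℝ} (hst : s ≤ t) :
    ∫ x in ball (0:E2) s, G x ≤ ∫ x in ball (0:E2) t, G x :=
  setIntegral_mono_set h.intG.integrableOn (Eventually.of_forall h.G0)
    (ball_subset_ball hst).eventuallyLE

lemma mass_le (h : Bub b C1 M lam τ F0 Z G) (s : Set E2) : ∫ x in s, G x ≤ M :=
  (setIntegral_le_integral h.intG (Eventually.of_forall h.G0)).trans h.hM

lemma core_mass (h : Bub b C1 M lam τ F0 Z G) {c : ℝ} (hc : 0 < c) (hF0 : c ≤ F0) (hτ : τ ≤ c / 2)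
    (hl4 : lam < 1 / 4) :
    Real.pi * (c / 2) * Real.exp (-(C1 + b + M)) ≤ ∫ x in ball (0:E2) lam, G x := by
  have hl := h.lam_pos
  have hM := h.M0
  have hb := h.b0
  have hC := h.C0
  have hsub : ball (0:E2) lam ⊆ ball 0 (1/4) := ball_subset_ball hl4.le
  have key : ∀ x ∈ ball (0:E2) lam, (c / 2) / lam ^ 2 * Real.exp (-(C1 + b + M)) ≤ G x := by
    intro x hx
    have hd : ‖Z x - Z 0‖ ≤ (C1 + b + M) / lam * ‖x - 0‖ := by
      refine (convex_ball (0:E2) lam).norm_image_sub_le_of_norm_fderiv_le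
        (fun y _ => h.hZ.differentiable (by norm_num) y) (fun y hy => ?_) (by simpa using hl) hx
      exact ContinuousLinearMap.opNorm_le_bound _ (by positivity) (fun ξ => h.grad_bound (hsub hy) ξ)
    have hx' : ‖x‖ < lam := by simpa using hx
    have hd2 : -(C1 + b + M) ≤ Z x - Z 0 := by
      rw [sub_zero] at hd
      have : (C1 + b + M) / lam * ‖x‖ ≤ (C1 + b + M) / lam * lam := by gcongr
      rw [div_mul_cancel₀ _ hl.ne'] at this
      exact (abs_le.1 (hd.trans this)).1
    have h1 := (abs_le.1 (h.hF x (hsub hx))).1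
    have h2 : (F0 - τ) / lam ^ 2 * Real.exp (Z x - Z 0) ≤ G x := by
      have : (F0 - τ) / lam ^ 2 * Real.exp (Z x - Z 0) = F0 / lam ^ 2 * Real.exp (Z x - Z 0) -
        τ / lam ^ 2 * Real.exp (Z x - Z 0) := by ring
      linarith
    refine le_trans ?_ h2
    have : c / 2 ≤ F0 - τ := by linarith
    have hq : 0 ≤ (F0 - τ) / lam ^ 2 := div_nonneg (by linarith) (by positivity)
    gcongr
  have := setIntegral_mono_on (μ := volume) (s := ball (0:E2) lam)
    (integrableOn_const (by exact measure_ball_lt_top.ne)) h.intG.integrableOn measurableSet_ball key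
  rw [setIntegral_const, vol_ball_real _ hl.le, smul_eq_mul] at this
  refine le_trans (le_of_eq ?_) this
  field_simp

end Bub

set_option maxHeartbeats 1000000 in
lemma concentration (b C1 M c : ℝ) (hb : 0 ≤ b) (hC : 0 ≤ C1) (hM : 0 ≤ M) (hc : 0 < c) :
    ∀ η : ℝ, 0 < η → ∃ R : ℝ, 1 ≤ R ∧ ∃ ρ > (0:ℝ), ∀ (lam τ F0 : ℝ) (Z G : E2 → ℝ),
      Bub b C1 M lam τ F0 Z G → c ≤ F0 → lam < ρ → τ < ρ →
      8 * Real.pi - η ≤ ∫ x in ball (0:E2) (R * lam), G x := by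
  intro η hη
  obtain ⟨Λ, hΛ, hP⟩ := pohozaev
  have hpi := Real.pi_pos
  set m0 := Real.pi * (c / 2) * Real.exp (-(C1 + b + M)) with hm0
  have hm0p : 0 < m0 := by positivity
  set κ := η * m0 / (4 * Real.pi) with hκ
  have hκp : 0 < κ := by positivity
  set K := 2 * Λ + 1 / (4 * Real.pi) * (2 * Λ * M) with hK
  have hKp : 0 < K := by positivity
  obtain ⟨L, hL3, hL⟩ : ∃ L : ℝ, 3 ≤ L ∧ 1 / (4 * Real.pi) * (M ^ 2 / (L - 1)) ≤ κ / 4 := by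
    refine ⟨3 + M ^ 2 / (Real.pi * κ), by linarith [show 0 ≤ M ^ 2 / (Real.pi * κ) by positivity], ?_⟩
    have hp : 0 ≤ M ^ 2 / (Real.pi * κ) := by positivity
    rw [← mul_div_assoc, div_le_iff₀ (by linarith)]
    have : κ / 4 * (M ^ 2 / (Real.pi * κ)) = 1 / (4 * Real.pi) * M ^ 2 := by field_simp
    nlinarith
  obtain ⟨N, hN⟩ := exists_nat_gt (M / (κ / (4 * K)))
  have hN0 : 0 < (N:ℝ) := lt_of_le_of_lt (by positivity) hN
  rw [div_lt_iff₀ (by positivity)] at hN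
  set R := L ^ N with hR
  have hL1 : 1 ≤ L := by linarith
  have hR1 : 1 ≤ R := one_le_pow₀ hL1
  set Q1 := 2 * C1 * R * M with hQ1
  set Q2 := 8 * Real.pi * R ^ 2 * ((C1 + b + M) * R + Λ) with hQ2
  have hQ1p : 0 ≤ Q1 := by positivity
  have hQ2p : 0 ≤ Q2 := by positivity
  refine ⟨R, hR1, min (min (c / 2) (κ / (4 * (Q2 + 1)))) (min (1 / (16 * R)) (κ / (4 * (Q1 + 1)))),
    by positivity, ?_⟩
  intro lam τ F0 Z G h hF0 hlam hτ
  have hl := h.lam_pos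
  have hτ0 := h.τ0
  simp only [lt_min_iff] at hlam hτ
  obtain ⟨⟨-, -⟩, hl1, hl2⟩ := hlam
  obtain ⟨⟨hτ1, hτ2⟩, -, -⟩ := hτ
  rw [lt_div_iff₀ (by positivity)] at hl1 hl2 hτ2
  have hl4 : lam < 1 / 4 := by nlinarith
  have hcm := h.core_mass hc hF0 hτ1.le hl4
  -- pigeonhole
  let mm : ℕ → ℝ := fun k => ∫ x in ball (0:E2) (L ^ k * lam), G x
  obtain ⟨k, hkN, hk⟩ : ∃ k ∈ Finset.range N, mm (k + 1) - mm k ≤ κ / (4 * K) := by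
    by_contra! hcon
    have h1 : ∑ k ∈ Finset.range N, κ / (4 * K) ≤ ∑ k ∈ Finset.range N, (mm (k + 1) - mm k) :=
      Finset.sum_le_sum fun k hk => (hcon k hk).le
    rw [Finset.sum_range_sub, Finset.sum_const, Finset.card_range, nsmul_eq_mul] at h1
    have h2 : mm N ≤ M := h.mass_le _
    have h3 : 0 ≤ mm 0 := integral_nonneg h.G0
    linarith
  set T := L ^ k with hT
  have hT1 : 1 ≤ T := one_le_pow₀ hL1
  have hTR : T ≤ R := pow_le_pow_right₀ hL1 (Finset.mem_range.1 hkN).le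
  set S := T * lam with hS
  have hSp : 0 < S := by positivity
  have hSR : S ≤ R * lam := by rw [hS]; gcongr
  have hP' := hP b C1 M lam τ F0 Z G h S L hSp (by linarith) hL3
  have hν : ∫ x in ball (0:E2) (L * S) \ ball 0 S, G x = mm (k + 1) - mm k := by
    rw [setIntegral_sdiff measurableSet_ball h.intG.integrableOn (ball_subset_ball (le_mul_of_one_le_left hSp.le hL1))]
    simp only [mm, hS, hT, pow_succ]
    congr 4
    ring
  rw [hν] at hP'
  set m := ∫ x in ball (0:E2) S, G x with hm
  have hmm0 : m0 ≤ m := hcm.trans (h.mass_mono (le_mul_of_one_le_left hl.le hT1))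
  set ν := mm (k + 1) - mm k with hνd
  have hSl : S / lam = T := by rw [hS]; field_simp
  rw [hSl] at hP'
  have b1 : K * ν ≤ κ / 4 := by
    rw [le_div_iff₀ (by positivity)] at hk
    linarith
  have b2 : 8 * Real.pi * τ * T ^ 2 * ((C1 + b + M) * T + Λ) ≤ κ / 4 := by
    have : 8 * Real.pi * τ * T ^ 2 * ((C1 + b + M) * T + Λ) ≤ 8 * Real.pi * τ * R ^ 2 * ((C1 + b + M) * R + Λ) := by
      gcongr
    have e : 8 * Real.pi * τ * R ^ 2 * ((C1 + b + M) * R + Λ) = τ * Q2 := by rw [hQ2]; ring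
    nlinarith
  have b3 : 2 * C1 * S * M ≤ κ / 4 := by
    have : 2 * C1 * S * M ≤ 2 * C1 * (R * lam) * M := by gcongr
    have e : 2 * C1 * (R * lam) * M = lam * Q1 := by rw [hQ1]; ring
    nlinarith
  have b4 : |1 / (4 * Real.pi) * m ^ 2 - 2 * m| ≤ κ := by
    refine hP'.trans ?_
    have e : K * ν = 2 * Λ * ν + 1 / (4 * Real.pi) * (2 * Λ * M * ν) := by rw [hK]; ring
    rw [mul_add]
    linarith
  have b5 : 8 * Real.pi - η ≤ m := by
    have e : 1 / (4 * Real.pi) * m ^ 2 - 2 * m = m / (4 * Real.pi) * (m - 8 * Real.pi) := by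
      field_simp; ring
    rw [e] at b4
    have b6 := (abs_le.1 b4).1
    by_contra! hcon
    have : m / (4 * Real.pi) * (m - 8 * Real.pi) < -κ := by
      have e2 : -κ = m0 / (4 * Real.pi) * (-η) := by rw [hκ]; ring
      have h1 : m0 / (4 * Real.pi) ≤ m / (4 * Real.pi) := by gcongr
      have h2 : 0 < m0 / (4 * Real.pi) := by positivity
      rw [e2]
      nlinarith
    linarith
  exact b5.trans (h.mass_mono hSR)
lemma line_null (x : E2) : ∀ᵐ y : E2, ∀ t : ℝ, t • x ≠ y := by
  have h1 : (Submodule.span ℝ {x}) ≠ ⊤ := by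
    intro h
    have h2 := finrank_span_le_card (R := ℝ) ({x} : Set E2)
    rw [h, finrank_top, finrank_E2] at h2
    simp at h2
  have h2 := Measure.addHaar_submodule (volume : Measure E2) _ h1
  have h3 : ∀ᵐ y : E2, y ∉ (Submodule.span ℝ {x} : Set E2) := by
    rw [ae_iff]; simpa using h2
  filter_upwards [h3] with y hy t ht
  exact hy (by rw [← ht]; exact Submodule.smul_mem _ _ (Submodule.mem_span_singleton_self x))

lemma log_ftc (x y : E2) (h : ∀ t : ℝ, t • x ≠ y) :
    ∫ t in (0:ℝ)..1, (inner ℝ x (t • x - y) : ℝ) / ‖t • x - y‖ ^ 2 =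
      Real.log ‖x - y‖ - Real.log ‖y‖ := by
  have hne : ∀ t : ℝ, ‖t • x - y‖ ≠ 0 := fun t => norm_ne_zero_iff.2 (sub_ne_zero.2 (h t))
  have hd : ∀ t : ℝ, HasDerivAt (fun t : ℝ => Real.log (‖t • x - y‖ ^ 2) / 2)
      ((inner ℝ x (t • x - y) : ℝ) / ‖t • x - y‖ ^ 2) t := by
    intro t
    have h1 : HasDerivAt (fun t : ℝ => t • x - y) x t := by
      simpa using ((hasDerivAt_id t).smul_const x).sub_const y
    have h2 := (h1.norm_sq.log (pow_ne_zero 2 (hne t))).div_const 2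
    refine h2.congr_deriv ?_
    rw [real_inner_comm]
    ring
  have hc : Continuous (fun t : ℝ => (inner ℝ x (t • x - y) : ℝ) / ‖t • x - y‖ ^ 2) := by
    refine Continuous.div (by fun_prop) (by fun_prop) (fun t => pow_ne_zero 2 (hne t))
  rw [intervalIntegral.integral_eq_sub_of_hasDerivAt (fun t _ => hd t) (hc.intervalIntegrable _ _)]
  simp only [one_smul, zero_smul, zero_sub, norm_neg, Real.log_pow]
  push_cast; ring

namespace Bub
variable {b C1 M lam τ F0 : ℝ} {Z G : E2 → ℝ}

lemma log_rep (h : Bub b C1 M lam τ F0 Z G) {x : E2} (hx : x ∈ ball (0:E2) (1/4)) :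
    |Z x - Z 0 + 1 / (2 * Real.pi) * ∫ y, G y * (Real.log ‖x - y‖ - Real.log ‖y‖)| ≤ C1 * ‖x‖ := by
  have hx' : ‖x‖ < 1 / 4 := by simpa using hx
  have hl := h.lam_pos
  have hmem : ∀ t ∈ Set.Ioc (0:ℝ) 1, t • x ∈ ball (0:E2) (1/4) := by
    intro t ht
    simp only [mem_ball, dist_zero_right, norm_smul, Real.norm_eq_abs, abs_of_pos ht.1]
    have := mul_le_mul_of_nonneg_right ht.2 (norm_nonneg x)
    linarith
  have hzc : Continuous (fun t : ℝ => fderiv ℝ Z (t • x) x) := by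
    have := h.hZ.continuous_fderiv (by norm_num)
    exact (this.comp (by fun_prop : Continuous fun t : ℝ => t • x)).clm_apply continuous_const
  have ftc : ∫ t in (0:ℝ)..1, fderiv ℝ Z (t • x) x = Z x - Z 0 := by
    have hd : ∀ t : ℝ, HasDerivAt (fun t : ℝ => Z (t • x)) (fderiv ℝ Z (t • x) x) t := by
      intro t
      have h1 : HasDerivAt (fun t : ℝ => t • x) x t := by
        simpa using (hasDerivAt_id t).smul_const x
      exact ((h.hZ.differentiable (by norm_num) (t • x)).hasFDerivAt).comp_hasDerivAt t h1
    rw [intervalIntegral.integral_eq_sub_of_hasDerivAt (fun t _ => hd t) (hzc.intervalIntegrable _ _)]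
    simp
  set k : ℝ → E2 → ℝ := fun t y => G y * (inner ℝ x (t • x - y) / ‖t • x - y‖ ^ 2) with hk
  set μ := (volume : Measure ℝ).restrict (Set.Ioc 0 1) with hμ
  have hm : AEStronglyMeasurable (Function.uncurry k) (μ.prod volume) := by
    refine Measurable.aestronglyMeasurable ?_
    have := h.hG.measurable
    simp only [hk, Function.uncurry_def]
    fun_prop
  have hkb : ∀ t y, ‖k t y‖ ≤ ‖x‖ * (G y * ‖t • x - y‖⁻¹) := by
    intro t y
    rw [hk, Real.norm_eq_abs, abs_mul, abs_of_nonneg (h.G0 y)]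
    have := mul_le_mul_of_nonneg_left (kern_le x (t • x - y)) (h.G0 y)
    linarith
  have hki : ∀ t, Integrable (k t) := by
    intro t
    refine Integrable.mono' ((h.integrable_pot' (t • x)).const_mul ‖x‖) ?_ (Eventually.of_forall (hkb t))
    refine Measurable.aestronglyMeasurable ?_
    have := h.hG.measurable
    simp only [hk]
    fun_prop
  have ik : Integrable (Function.uncurry k) (μ.prod volume) := by
    rw [integrable_prod_iff hm]
    refine ⟨Eventually.of_forall hki, ?_⟩
    refine Integrable.mono' (integrable_const (‖x‖ * (2 * Real.pi * (b / lam ^ 2) * lam + M / lam)))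
      hm.norm.integral_prod_right' (Eventually.of_forall fun t => ?_)
    rw [Real.norm_eq_abs, abs_of_nonneg (integral_nonneg fun y => norm_nonneg _)]
    calc ∫ y, ‖Function.uncurry k (t, y)‖ ≤ ∫ y, ‖x‖ * (G y * ‖t • x - y‖⁻¹) :=
          integral_mono (hki t).norm ((h.integrable_pot' (t • x)).const_mul ‖x‖) (hkb t)
      _ = ‖x‖ * ∫ y, (G y * ‖t • x - y‖⁻¹) := integral_const_mul _ _
      _ ≤ _ := mul_le_mul_of_nonneg_left (h.pot_le _) (norm_nonneg _)
  have sw : ∫ t in (0:ℝ)..1, ∫ y, k t y = ∫ y, G y * (Real.log ‖x - y‖ - Real.log ‖y‖) := by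
    rw [intervalIntegral.integral_of_le zero_le_one, integral_integral_swap ik]
    refine integral_congr_ae ?_
    filter_upwards [line_null x] with y hy
    simp only [hk]
    rw [integral_const_mul, ← log_ftc x y hy, intervalIntegral.integral_of_le zero_le_one]
  have iK : IntervalIntegrable (fun t => ∫ y, k t y) volume 0 1 := by
    rw [intervalIntegrable_iff_integrableOn_Ioc_of_le zero_le_one]
    exact ik.integral_prod_left
  rw [← ftc, ← sw, ← intervalIntegral.integral_const_mul,
    ← intervalIntegral.integral_add (hzc.intervalIntegrable _ _) (iK.const_mul _), ← Real.norm_eq_abs]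
  have := intervalIntegral.norm_integral_le_of_norm_le_const (a := 0) (b := 1) (C := C1 * ‖x‖)
    (f := fun t => fderiv ℝ Z (t • x) x + 1 / (2 * Real.pi) * ∫ y, k t y) (fun t ht => by
      rw [Set.uIoc_of_le zero_le_one] at ht
      exact h.GR (t • x) (hmem t ht) x)
  simpa using this

lemma log_core {x y : E2} {R lam : ℝ} (hl : 0 < lam) (hR : 1 ≤ R) (hx : 2 * R * lam ≤ ‖x‖)
    (hy : ‖y‖ < R * lam) (hy0 : y ≠ 0) :
    |Real.log ‖x - y‖ - Real.log ‖y‖ - Real.log (‖x‖ / lam)| ≤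
      Real.log 2 + Real.log R + lam * ‖y‖⁻¹ := by
  have hyp : 0 < ‖y‖ := norm_pos_iff.2 hy0
  have hRp : 0 < R := by linarith
  have hxp : 0 < ‖x‖ := lt_of_lt_of_le (by positivity) hx
  have a1 := norm_sub_norm_le x y
  have a2 := norm_sub_le x y
  have hlo : ‖x‖ / 2 ≤ ‖x - y‖ := by linarith
  have hhi : ‖x - y‖ ≤ ‖x‖ * 2 := by linarith
  have hxyp : 0 < ‖x - y‖ := by linarith
  have b1 := Real.log_le_log (by positivity) hlo
  have b2 := Real.log_le_log hxyp hhi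
  rw [Real.log_div hxp.ne' two_ne_zero] at b1
  rw [Real.log_mul hxp.ne' two_ne_zero] at b2
  rw [Real.log_div hxp.ne' hl.ne']
  have b3 := Real.log_le_log hyp hy.le
  rw [Real.log_mul hRp.ne' hl.ne'] at b3
  have b4 := Real.log_le_sub_one_of_pos (show 0 < lam * ‖y‖⁻¹ by positivity)
  rw [Real.log_mul hl.ne' (inv_ne_zero hyp.ne'), Real.log_inv] at b4
  have b5 := Real.log_nonneg hR
  have b6 := Real.log_nonneg one_le_two
  have b7 : 0 < lam * ‖y‖⁻¹ := by positivity
  rw [abs_le]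
  constructor <;> linarith

lemma log_tail {x y : E2} {lam : ℝ} (hl : 0 < lam) (hx : lam ≤ ‖x‖)
    (hy : lam ≤ ‖y‖) (hxy : x ≠ y) :
    |Real.log ‖x - y‖ - Real.log ‖y‖| ≤
      Real.log (‖x‖ / lam) + Real.log 2 + lam * ‖x - y‖⁻¹ := by
  have hyp : 0 < ‖y‖ := by linarith
  have hxp : 0 < ‖x‖ := by linarith
  have hd : 0 < ‖x - y‖ := norm_pos_iff.2 (sub_ne_zero.2 hxy)
  have b7 : 0 < lam * ‖x - y‖⁻¹ := by positivity
  have e : Real.log (‖x‖ / lam) + Real.log 2 = Real.log (‖x‖ * 2) - Real.log lam := by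
    rw [Real.log_div hxp.ne' hl.ne', Real.log_mul hxp.ne' two_ne_zero]; ring
  have a2 := norm_sub_le x y
  have a3 : ‖y‖ ≤ ‖x - y‖ + ‖x‖ := by
    have := norm_sub_norm_le y x
    rw [norm_sub_rev] at this; linarith
  rw [e, abs_le]
  have key : ∀ p q : ℝ, 0 < p → lam ≤ q → p ≤ q + ‖x‖ →
      Real.log p - Real.log q ≤ Real.log (‖x‖ * 2) - Real.log lam := by
    intro p q hp hq hpq
    have hqp : 0 < q := by linarith
    have : Real.log (p * lam) ≤ Real.log (‖x‖ * 2 * q) := by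
      refine Real.log_le_log (by positivity) ?_
      nlinarith
    rw [Real.log_mul hp.ne' hl.ne', Real.log_mul (by positivity) hqp.ne'] at this
    linarith
  constructor
  · rcases le_or_gt lam ‖x - y‖ with h1 | h1
    · have := key ‖y‖ ‖x - y‖ hyp h1 a3
      linarith
    · have h2 : ‖y‖ ≤ ‖x‖ * 2 := by linarith
      have b2 := Real.log_le_log hyp h2
      have b4 := Real.log_le_sub_one_of_pos b7
      rw [Real.log_mul hl.ne' (inv_ne_zero hd.ne'), Real.log_inv] at b4
      linarith
  · have := key ‖x - y‖ ‖y‖ hd hy (by linarith)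
    linarith

lemma main_est (h : Bub b C1 M lam τ F0 Z G) {η R : ℝ} (hη : 0 ≤ η) (hR : 1 ≤ R)
    (hup : ∫ y, G y ≤ 8 * Real.pi + η)
    (hlow : 8 * Real.pi - η ≤ ∫ y in ball (0:E2) (R * lam), G y)
    {x : E2} (hx : x ∈ ball (0:E2) (1/4)) (hxR : 2 * R * lam ≤ ‖x‖) :
    |Z x - Z 0 + 4 * Real.log (‖x‖ / lam)| ≤ η * Real.log (‖x‖ / lam) +
      (C1 + M * (Real.log 2 + Real.log R) + 2 * (2 * Real.pi * b + M)) := by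
  have hl := h.lam_pos
  have hM := h.M0
  have hb := h.b0
  have hC := h.C0
  have hpi := Real.pi_gt_three
  have hRl : lam ≤ R * lam := le_mul_of_one_le_left hl.le hR
  have hx' : ‖x‖ < 1 / 4 := by simpa using hx
  have hlx : lam ≤ ‖x‖ := by linarith
  have hlog2 := Real.log_nonneg one_le_two
  have hlogR := Real.log_nonneg hR
  set l := Real.log (‖x‖ / lam) with hldef
  have hl0 : 0 ≤ l := Real.log_nonneg (by rw [le_div_iff₀ hl]; linarith)
  set B := ball (0:E2) (R * lam) with hB
  have mB : MeasurableSet B := measurableSet_ball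
  set m := ∫ y in B, G y with hm
  have htail : ∫ y in Bᶜ, G y ≤ 2 * η := by
    have := integral_add_compl mB h.intG
    linarith
  have htail0 : 0 ≤ ∫ y in Bᶜ, G y := integral_nonneg h.G0
  have hmM : m ≤ 8 * Real.pi + η := (setIntegral_le_integral h.intG (Eventually.of_forall h.G0)).trans hup
  have hpot : ∀ z : E2, lam * ∫ y, G y * ‖z - y‖⁻¹ ≤ 2 * Real.pi * b + M := by
    intro z
    calc _ ≤ lam * (2 * Real.pi * (b / lam ^ 2) * lam + M / lam) := by
          have := h.pot_le z
          gcongr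
      _ = _ := by field_simp
  set I := ∫ y, G y * (Real.log ‖x - y‖ - Real.log ‖y‖) with hI
  -- pointwise bound
  have i1 : Integrable (fun y => l * Bᶜ.indicator G y) := (h.intG.indicator mB.compl).const_mul _
  have i2 : Integrable (fun y => (Real.log 2 + Real.log R) * G y) := h.intG.const_mul _
  have i3 : Integrable (fun y => lam * (G y * ‖(0:E2) - y‖⁻¹)) := (h.integrable_pot' 0).const_mul _
  have i4 : Integrable (fun y => lam * (G y * ‖x - y‖⁻¹)) := (h.integrable_pot' x).const_mul _
  have i0 : Integrable (fun y => l * B.indicator G y) := (h.intG.indicator mB).const_mul _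
  set bd : E2 → ℝ := fun y => l * Bᶜ.indicator G y + (Real.log 2 + Real.log R) * G y +
    lam * (G y * ‖(0:E2) - y‖⁻¹) + lam * (G y * ‖x - y‖⁻¹) with hbd
  have ibd : Integrable bd := ((i1.add i2).add i3).add i4
  have pw : ∀ᵐ y, ‖G y * (Real.log ‖x - y‖ - Real.log ‖y‖) - l * B.indicator G y‖ ≤ bd y := by
    filter_upwards [line_null x] with y hy
    have hy0 : y ≠ 0 := fun h0 => hy 0 (by simp [h0])
    have hxy : x ≠ y := fun h0 => hy 1 (by simp [h0])
    have g := h.G0 y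
    have q1 : 0 ≤ lam * (G y * ‖(0:E2) - y‖⁻¹) := by positivity
    have q2 : 0 ≤ lam * (G y * ‖x - y‖⁻¹) := by positivity
    simp only [hbd]
    by_cases hyB : y ∈ B
    · have hyB' : ‖y‖ < R * lam := by simpa [hB] using hyB
      rw [Set.indicator_of_mem hyB, Set.indicator_of_notMem (by simpa using hyB), mul_comm l, ← mul_sub,
        norm_mul, Real.norm_eq_abs, Real.norm_eq_abs, abs_of_nonneg g]
      have := mul_le_mul_of_nonneg_left (log_core hl hR hxR hyB' hy0) g
      rw [zero_sub, norm_neg] at q1 ⊢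
      linarith
    · have hyB' : R * lam ≤ ‖y‖ := by simpa [hB] using hyB
      rw [Set.indicator_of_notMem hyB, Set.indicator_of_mem (by simpa using hyB), mul_zero, sub_zero,
        norm_mul, Real.norm_eq_abs, Real.norm_eq_abs, abs_of_nonneg g]
      have := mul_le_mul_of_nonneg_left (log_tail hl hlx (hRl.trans hyB') hxy) g
      have q3 : 0 ≤ Real.log R * G y := by positivity
      linarith
  have iL : Integrable (fun y => G y * (Real.log ‖x - y‖ - Real.log ‖y‖)) := by
    have hmeas : AEStronglyMeasurable (fun y => G y * (Real.log ‖x - y‖ - Real.log ‖y‖) - l * B.indicator G y) := by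
      refine Measurable.aestronglyMeasurable ?_
      have := h.hG.measurable
      have := this.indicator mB
      fun_prop
    have := (Integrable.mono' ibd hmeas pw).add i0
    refine this.congr (Eventually.of_forall fun y => ?_)
    simp
  have est : |I - l * m| ≤ l * (2 * η) + (M * (Real.log 2 + Real.log R) + 2 * (2 * Real.pi * b + M)) := by
    have e : I - l * m = ∫ y, (G y * (Real.log ‖x - y‖ - Real.log ‖y‖) - l * B.indicator G y) := by
      rw [integral_sub iL i0, integral_const_mul, integral_indicator mB]
    rw [e, ← Real.norm_eq_abs]
    refine (norm_integral_le_of_norm_le ibd pw).trans ?_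
    simp only [hbd]
    rw [integral_add (by exact (i1.add i2).add i3) i4, integral_add (by exact i1.add i2) i3,
      integral_add i1 i2, integral_const_mul, integral_const_mul, integral_const_mul, integral_const_mul,
      integral_indicator mB.compl]
    have r1 := hpot 0
    have r2 := hpot x
    have r3 : l * ∫ y in Bᶜ, G y ≤ l * (2 * η) := by gcongr
    have r4 : (Real.log 2 + Real.log R) * ∫ y, G y ≤ (Real.log 2 + Real.log R) * M := by
      have := h.hM
      gcongr
    linarith
  have lr := h.log_rep hx
  rw [← hI] at lr
  have lr2 : |Z x - Z 0 + 1 / (2 * Real.pi) * I| ≤ C1 :=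
    lr.trans (mul_le_of_le_one_right hC (by linarith))
  have e : Z x - Z 0 + 4 * l = (Z x - Z 0 + 1 / (2 * Real.pi) * I) -
      1 / (2 * Real.pi) * ((I - l * m) + l * (m - 8 * Real.pi)) := by
    field_simp; ring
  have hm8 : |m - 8 * Real.pi| ≤ η := by rw [abs_le]; constructor <;> linarith
  have f1 : |(I - l * m) + l * (m - 8 * Real.pi)| ≤
      l * (3 * η) + (M * (Real.log 2 + Real.log R) + 2 * (2 * Real.pi * b + M)) := by
    refine (abs_add_le _ _).trans ?_
    rw [abs_mul, abs_of_nonneg hl0]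
    have := mul_le_mul_of_nonneg_left hm8 hl0
    linarith
  rw [e]
  refine (abs_sub _ _).trans ?_
  rw [abs_mul, abs_of_pos (by positivity : 0 < 1 / (2 * Real.pi))]
  set KR := M * (Real.log 2 + Real.log R) + 2 * (2 * Real.pi * b + M) with hKR
  have hKR0 : 0 ≤ KR := by positivity
  have hle : 1 / (2 * Real.pi) ≤ 1 / 6 := by
    apply one_div_le_one_div_of_le <;> linarith
  have f2 : 1 / (2 * Real.pi) * |(I - l * m) + l * (m - 8 * Real.pi)| ≤ 1 / 6 * (l * (3 * η) + KR) := by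
    gcongr
  have : 0 ≤ l * η := by positivity
  linarith

end Bub
lemma second_deriv_test {h h1 : ℝ → ℝ} {h2 ε a c : ℝ} (hd : ∀ᶠ t in nhds (0:ℝ), HasDerivAt h (h1 t) t)
    (hd2 : HasDerivAt h1 h2 0)
    (hmin : IsLocalMin (fun t => h t - ε * (a + 2 * c * t + t ^ 2)) 0) : 2 * ε ≤ h2 := by
  by_contra! hcon
  set g : ℝ → ℝ := fun t => h t - ε * (a + 2 * c * t + t ^ 2) with hg
  have hp : ∀ t : ℝ, HasDerivAt (fun t : ℝ => ε * (a + 2 * c * t + t ^ 2)) (ε * (2 * c + 2 * t)) t := by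
    intro t
    have h1 : HasDerivAt (fun t : ℝ => 2 * c * t) (2 * c) t := by
      simpa using (hasDerivAt_id t).const_mul (2 * c)
    have h2 : HasDerivAt (fun t : ℝ => t ^ 2) (2 * t) t := by simpa using hasDerivAt_pow 2 t
    exact ((h1.const_add a).add h2).const_mul ε
  have hgd : ∀ᶠ t in nhds (0:ℝ), HasDerivAt g (h1 t - ε * (2 * c + 2 * t)) t := by
    filter_upwards [hd] with t ht using ht.sub (hp t)
  have hgd' : deriv g =ᶠ[nhds 0] fun t => h1 t - ε * (2 * c + 2 * t) := by
    filter_upwards [hgd] with t ht using ht.deriv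
  have hq : HasDerivAt (fun t : ℝ => ε * (2 * c + 2 * t)) (ε * 2) 0 := by
    have h1 : HasDerivAt (fun t : ℝ => 2 * t) 2 (0:ℝ) := by
      simpa using (hasDerivAt_id (0:ℝ)).const_mul 2
    exact (h1.const_add _).const_mul ε
  have hgdd : HasDerivAt (deriv g) (h2 - ε * 2) 0 := (hd2.sub hq).congr_of_eventuallyEq hgd'
  have hg0 : deriv g 0 = 0 := hmin.deriv_eq_zero
  have hmax : IsLocalMax g 0 := isLocalMax_of_deriv_deriv_neg (by rw [hgdd.deriv]; linarith) hg0
    hgd.self_of_nhds.continuousAt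
  have hconst : g =ᶠ[nhds 0] fun _ => g 0 := by
    filter_upwards [hmin, hmax] with t h1 h2 using le_antisymm h2 h1
  have hdz : deriv g =ᶠ[nhds 0] fun _ => 0 := by
    filter_upwards [hconst.eventuallyEq_nhds] with t ht
    rw [ht.deriv_eq]; simp
  have := hdz.deriv_eq
  rw [hgdd.deriv] at this
  simp at this
  linarith

lemma contDiffAt_pd {u : E2 → ℝ} {x : E2} (hu : ContDiffAt ℝ 2 u x) (j : Fin 2) :
    ContDiffAt ℝ 1 (pd j u) x := by
  have := hu.fderiv_right (m := 1) (by norm_num)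
  exact this.clm_apply contDiffAt_const

lemma min_principle {u : E2 → ℝ} (hu : ContDiffOn ℝ 2 u (closedBall (0:E2) 1))
    (hl : ∀ x ∈ ball (0:E2) 1, lapl u x ≤ 0) (hb : ∀ x ∈ sphere (0:E2) 1, u x = 0) :
    ∀ x ∈ closedBall (0:E2) 1, 0 ≤ u x := by
  intro x0 hx0
  by_contra! hneg
  set ε := -u x0 / 2 with hε
  have hεp : 0 < ε := by rw [hε]; linarith
  have hc : ContinuousOn (fun x => u x - ε * ‖x‖ ^ 2) (closedBall (0:E2) 1) :=
    hu.continuousOn.sub (by fun_prop)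
  obtain ⟨x, hx, hmin⟩ := (isCompact_closedBall (0:E2) 1).exists_isMinOn ⟨x0, hx0⟩ hc
  have hm0 : u x - ε * ‖x‖ ^ 2 ≤ u x0 - ε * ‖x0‖ ^ 2 := hmin hx0
  have hxb : x ∈ ball (0:E2) 1 := by
    by_contra hxn
    have hx1 : ‖x‖ = 1 := le_antisymm (by simpa using hx) (by simpa using hxn)
    have hux := hb x (by simpa using hx1)
    rw [hx1, hux] at hm0
    have : 0 ≤ ε * ‖x0‖ ^ 2 := by positivity
    have : u x0 = -2 * ε := by rw [hε]; ring
    linarith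
  have hnh : ball (0:E2) 1 ∈ nhds x := isOpen_ball.mem_nhds hxb
  have hcd : ∀ y ∈ ball (0:E2) 1, ContDiffAt ℝ 2 u y := fun y hy =>
    (hu.mono ball_subset_closedBall).contDiffAt (isOpen_ball.mem_nhds hy)
  have hj : ∀ j : Fin 2, 2 * ε ≤ pd j (pd j u) x := by
    intro j
    set e : E2 := EuclideanSpace.single j 1 with he
    have hline : ∀ t : ℝ, HasDerivAt (fun t : ℝ => x + t • e) e t := fun t => by
      simpa using ((hasDerivAt_id t).smul_const e).const_add x
    have hev : ∀ᶠ t in nhds (0:ℝ), x + t • e ∈ ball (0:E2) 1 := by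
      have : ContinuousAt (fun t : ℝ => x + t • e) 0 := by fun_prop
      exact this.eventually_mem (by simpa using hnh)
    refine second_deriv_test (h := fun t => u (x + t • e)) (h1 := fun t => pd j u (x + t • e))
      (a := ‖x‖ ^ 2) (c := x j) ?_ ?_ ?_
    · filter_upwards [hev] with t ht
      exact ((hcd _ ht).differentiableAt (by norm_num)).hasFDerivAt.comp_hasDerivAt t (hline t)
    · have h1 : HasFDerivAt (pd j u) (fderiv ℝ (pd j u) x) (x + (0:ℝ) • e) := by
        rw [zero_smul, add_zero]
        exact ((contDiffAt_pd (hcd x hxb) j).differentiableAt (by norm_num)).hasFDerivAt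
      exact h1.comp_hasDerivAt (0:ℝ) (hline 0)
    · filter_upwards [hev] with t ht
      have := hmin (ball_subset_closedBall ht)
      simp only [Set.mem_ofPred_eq] at this
      have e1 : ‖x + t • e‖ ^ 2 = ‖x‖ ^ 2 + 2 * x j * t + t ^ 2 := by
        rw [norm_add_sq_real, inner_smul_right, norm_smul, he]
        simp [EuclideanSpace.inner_single_right]
        ring
      rw [e1] at this
      simpa using this
  have := hl x hxb
  have a0 := hj 0
  have a1 := hj 1
  unfold lapl at this
  linarith

lemma pd_affine (f : E2 → ℝ) (x : E2) {d : ℝ} (j : Fin 2) (y : E2) :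
    pd j (fun y => f (x + d • y)) y = d * pd j f (x + d • y) := by
  unfold pd
  have h1 := fderiv_comp_smul (𝕜 := ℝ) (f := fun z => f (x + z)) (c := d) (x := y)
  have h2 := fderiv_comp_add_left (𝕜 := ℝ) (f := f) (x := d • y) x
  rw [h2] at h1
  rw [h1]
  simp

lemma lapl_affine (f : E2 → ℝ) (x : E2) {d : ℝ} (y : E2) :
    lapl (fun y => f (x + d • y)) y = d ^ 2 * lapl f (x + d • y) := by
  have key : ∀ j, pd j (pd j (fun y => f (x + d • y))) y = d ^ 2 * pd j (pd j f) (x + d • y) := by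
    intro j
    have : pd j (fun y => f (x + d • y)) = fun y => (fun z => d * pd j f z) (x + d • y) := by
      funext y; exact pd_affine f x j y
    rw [this, pd_affine (fun z => d * pd j f z)]
    have h2 : pd j (fun z => d * pd j f z) (x + d • y) = d * pd j (pd j f) (x + d • y) := by
      show fderiv ℝ (fun z => d * pd j f z) _ _ = _
      rw [show (fun z => d * pd j f z) = d • pd j f from rfl, fderiv_const_smul_field]; rfl
    rw [h2]; ring
  unfold lapl
  rw [key, key]; ring

lemma integral_affine (f : E2 → ℝ) (x : E2) {d : ℝ} (hd : 0 < d) :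
    ∫ y in ball (0:E2) (1/2), d ^ 2 * f (x + d • y) = ∫ y in ball x (d / 2), f y := by
  rw [← integral_indicator measurableSet_ball, ← integral_indicator measurableSet_ball]
  set F := (ball x (d / 2)).indicator f with hF
  have e1 : (ball (0:E2) (1/2)).indicator (fun y => d ^ 2 * f (x + d • y)) =
      fun y => d ^ 2 * F (x + d • y) := by
    funext y
    have hiff : y ∈ ball (0:E2) (1/2) ↔ x + d • y ∈ ball x (d / 2) := by
      simp only [mem_ball, dist_zero_right, dist_self_add_left, norm_smul, Real.norm_eq_abs, abs_of_pos hd]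
      rw [lt_div_iff₀ two_pos, lt_div_iff₀ two_pos]
      constructor <;> intro h <;> nlinarith
    by_cases hy : y ∈ ball (0:E2) (1/2)
    · rw [Set.indicator_of_mem hy, hF, Set.indicator_of_mem (hiff.1 hy)]
    · rw [Set.indicator_of_notMem hy, hF, Set.indicator_of_notMem (fun h => hy (hiff.2 h)), mul_zero]
  rw [e1, integral_const_mul]
  have h1 := Measure.integral_comp_smul (volume : Measure E2) (fun z => F (x + z)) d
  rw [h1, finrank_E2, integral_add_left_eq_self F x, abs_of_pos (by positivity), smul_eq_mul]
  field_simp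

lemma infDist_facts {x : E2} (hx : x ∈ ball (0:E2) 1) :
    0 < infDist x (sphere (0:E2) 1) ∧ infDist x (sphere (0:E2) 1) ≤ 1 - ‖x‖ := by
  have hx' : ‖x‖ < 1 := by simpa using hx
  have hne : (sphere (0:E2) 1).Nonempty := NormedSpace.sphere_nonempty.2 zero_le_one
  constructor
  · rw [← isClosed_sphere.notMem_iff_infDist_pos hne]
    simp; linarith
  · by_cases h0 : x = 0
    · obtain ⟨z, hz⟩ := hne
      refine (infDist_le_dist_of_mem hz).trans ?_
      have : ‖z‖ = 1 := by simpa using hz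
      rw [h0, dist_zero_left, this]; simp
    · have hp : 0 < ‖x‖ := norm_pos_iff.2 h0
      have hz : ‖x‖⁻¹ • x ∈ sphere (0:E2) 1 := by
        simp [norm_smul, hp.ne']
      refine (infDist_le_dist_of_mem hz).trans ?_
      rw [dist_comm, dist_eq_norm]
      have : ‖x‖⁻¹ • x - x = (‖x‖⁻¹ - 1) • x := by rw [sub_smul, one_smul]
      rw [this, norm_smul, Real.norm_eq_abs, abs_of_nonneg]
      · rw [sub_mul, inv_mul_cancel₀ hp.ne', one_mul]
      · rw [sub_nonneg]; exact (one_le_inv₀ hp).2 hx'.le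

lemma baire_annulus {u : ℕ → E2 → ℝ} {x_ : ℕ → E2} {δ : ℕ → ℝ}
    (hc : ∀ i, ContinuousOn (u i) (closedBall (0:E2) 1))
    (hmem : ∀ i, ∀ y : E2, ‖y‖ < 1 → x_ i + δ i • y ∈ ball (0:E2) 1)
    (hbound : ∀ ε : ℝ, 0 < ε → ε < 1 → ∃ Cε : ℝ, ∀ i, ∀ y : E2, ‖y‖ = ε →
      u i (x_ i + δ i • y) ≤ Cε) :
    ∃ α β n : ℝ, 1 / 4 < α ∧ α < β ∧ β < 1 / 2 ∧ 0 ≤ n ∧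
      ∀ i, ∀ y : E2, α ≤ ‖y‖ → ‖y‖ ≤ β → u i (x_ i + δ i • y) ≤ n := by
  let c : ℝ → ℝ := fun e => 7 / 20 + 1 / 40 * Real.arctan e
  have hpi := Real.pi_lt_four
  have hc1 : ∀ e, 1 / 4 < c e := fun e => by
    have := Real.neg_pi_div_two_lt_arctan e
    simp only [c]; linarith
  have hc2 : ∀ e, c e < 1 / 2 := fun e => by
    have := Real.arctan_lt_pi_div_two e
    simp only [c]; linarith
  have hcc : Continuous c := by
    have := Real.continuous_arctan
    simp only [c]; fun_prop
  have hcm : StrictMono c := fun a b hab => by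
    have := Real.arctan_strictMono hab
    simp only [c]; linarith
  let F : ℕ → Set ℝ := fun n => {e | ∀ i, ∀ ω : E2, ‖ω‖ = 1 → u i (x_ i + δ i • (c e • ω)) ≤ n}
  have hnorm : ∀ e, ∀ ω : E2, ‖ω‖ = 1 → ‖c e • ω‖ = c e := fun e ω hω => by
    rw [norm_smul, hω, mul_one, Real.norm_eq_abs, abs_of_pos (by linarith [hc1 e])]
  have hFc : ∀ n, IsClosed (F n) := by
    intro n
    simp only [F, Set.ofPred_forall]
    refine isClosed_iInter fun i => isClosed_iInter fun ω => isClosed_iInter fun hω => ?_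
    refine isClosed_le ?_ continuous_const
    refine (hc i).comp_continuous (by fun_prop) (fun e => ball_subset_closedBall (hmem i _ ?_))
    rw [hnorm e ω hω]; linarith [hc2 e]
  have hFU : ⋃ n, F n = Set.univ := by
    rw [Set.eq_univ_iff_forall]
    intro e
    obtain ⟨C, hC⟩ := hbound (c e) (by linarith [hc1 e]) (by linarith [hc2 e])
    obtain ⟨n, hn⟩ := exists_nat_ge C
    exact Set.mem_iUnion.2 ⟨n, fun i ω hω => (hC i _ (hnorm e ω hω)).trans hn⟩
  obtain ⟨n, e0, he0⟩ := nonempty_interior_of_iUnion_of_closed hFc hFU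
  obtain ⟨ρ, hρ, hball⟩ := Metric.isOpen_iff.1 isOpen_interior e0 he0
  refine ⟨c e0, c (e0 + ρ / 2), n, hc1 _, hcm (by linarith), hc2 _, Nat.cast_nonneg n, ?_⟩
  intro i y h1 h2
  obtain ⟨e, he, hey⟩ := intermediate_value_Icc (show e0 ≤ e0 + ρ / 2 by linarith) hcc.continuousOn
    (show ‖y‖ ∈ Set.Icc (c e0) (c (e0 + ρ / 2)) from ⟨h1, h2⟩)
  have heF : e ∈ F n := interior_subset (hball (by
    rw [mem_ball, Real.dist_eq, abs_lt]; constructor <;> linarith [he.1, he.2]))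
  have hyp : 0 < ‖y‖ := by linarith [hc1 e0]
  have := heF i (‖y‖⁻¹ • y) (by rw [norm_smul, norm_inv, norm_norm, inv_mul_cancel₀ hyp.ne'])
  rwa [hey, smul_smul (‖y‖), mul_inv_cancel₀ hyp.ne', one_smul] at this
lemma contDiff_cut {ψ w : E2 → ℝ} (hψ : ContDiff ℝ 2 ψ) (h0 : ∀ y, 3 / 4 ≤ ‖y‖ → ψ y = 0)
    (hw : ContDiffOn ℝ 2 w (ball (0:E2) 1)) : ContDiff ℝ 2 (fun y => ψ y * w y) := by
  rw [contDiff_iff_contDiffAt]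
  intro y
  by_cases hy : ‖y‖ < 1
  · exact hψ.contDiffAt.mul (hw.contDiffAt (isOpen_ball.mem_nhds (by simpa using hy)))
  · have : (fun y => ψ y * w y) =ᶠ[nhds y] fun _ => 0 := by
      have : (closedBall (0:E2) (3/4))ᶜ ∈ nhds y :=
        isClosed_closedBall.isOpen_compl.mem_nhds (by simp; simp at hy; linarith)
      filter_upwards [this] with z hz
      rw [h0 z (by simp at hz; exact hz.le), zero_mul]
    exact contDiffAt_const.congr_of_eventuallyEq this

lemma mk_bub {α β n C1 : ℝ} {χ : E2 → ℝ} (hχ : ContDiff ℝ 2 χ) (hχs : HasCompactSupport χ)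
    (hα : 1 / 4 < α) (hβ : β < 1 / 2) (h1 : ∀ y ∈ ball (0:E2) α, χ y = 1)
    (h0 : ∀ y, y ∉ closedBall (0:E2) β → χ y = 0) (hχ0 : ∀ y, 0 ≤ χ y) (hχ1 : ∀ y, χ y ≤ 1)
    (hC1 : 0 ≤ C1)
    (hGR : ∀ Z : E2 → ℝ, ContDiff ℝ 2 Z →
      (∀ y, α ≤ ‖y‖ → ‖y‖ ≤ β → |Z y| ≤ n) → ∀ x ∈ ball (0:E2) (1/4), ∀ ξ : E2,
      |fderiv ℝ Z x ξ + 1 / (2 * Real.pi) *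
        ∫ y, (χ y * (-lapl Z y)) * (inner ℝ ξ (x - y) / ‖x - y‖ ^ 2)| ≤ C1 * ‖ξ‖)
    {u V : E2 → ℝ} {x : E2} {δ r b M τ : ℝ} (hδ : 0 < δ) (hb : 0 ≤ b)
    (hu : ContDiffOn ℝ 2 u (closedBall (0:E2) 1))
    (hmem : ∀ y : E2, ‖y‖ < 1 → x + δ • y ∈ ball (0:E2) 1)
    (hVb : ∀ x ∈ ball (0:E2) 1, 0 ≤ V x ∧ V x ≤ b)
    (hVh : ∀ y : E2, ‖y‖ < 1 → |V (x + δ • y) - V x| ≤ τ)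
    (hpde : ∀ x ∈ ball (0:E2) 1, -(lapl u x) = V x * Real.exp (u x))
    (hmax : ∀ y ∈ closedBall (0:E2) 1, u y ≤ u x)
    (hr : r = Real.exp (-(u x) / 2)) (hrδ : r / δ ≤ 1)
    (hn : ∀ y : E2, α ≤ ‖y‖ → ‖y‖ ≤ β → |u (x + δ • y)| ≤ n)
    (hM : ∫ y in ball x (δ / 2), V y * Real.exp (u y) ≤ M) :
    ∃ Z G : E2 → ℝ, Bub b C1 M (r / δ) τ (V x) Z G ∧
      (∀ y, ‖y‖ < 1 / 2 → Z y = u (x + δ • y)) ∧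
      ∫ y, G y ≤ ∫ y in ball x (δ / 2), V y * Real.exp (u y) := by
  have hrp : 0 < r := by rw [hr]; exact Real.exp_pos _
  set lam := r / δ with hlam
  have hl : 0 < lam := by positivity
  let ψ : ContDiffBump (0:E2) := ⟨1/2, 3/4, by norm_num, by norm_num⟩
  set w : E2 → ℝ := fun y => u (x + δ • y) with hw
  have hwc : ContDiffOn ℝ 2 w (ball (0:E2) 1) := by
    refine hu.comp (t := closedBall (0:E2) 1) ?_ (fun y hy => ball_subset_closedBall (hmem y (by simpa using hy)))
    fun_prop
  set Z : E2 → ℝ := fun y => ψ y * w y with hZ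
  have hZc : ContDiff ℝ 2 Z := contDiff_cut ψ.contDiff (fun y hy => ψ.zero_of_le_dist (by simpa using hy)) hwc
  have hZw : ∀ y, ‖y‖ < 1 / 2 → Z y = w y := by
    intro y hy
    have : ψ y = 1 := ψ.one_of_mem_closedBall (by
      rw [mem_closedBall, dist_zero_right]; exact hy.le)
    rw [hZ]; simp only [this, one_mul]
  have hexp : ∀ y, δ ^ 2 * Real.exp (w y) = 1 / lam ^ 2 * Real.exp (w y - u x) := by
    intro y
    have e1 : r ^ 2 = Real.exp (-(u x)) := by
      rw [hr, ← Real.exp_nat_mul]; congr 1; push_cast; ring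
    have e2 : Real.exp (w y - u x) = Real.exp (w y) * r ^ 2 := by
      rw [e1, ← Real.exp_add]; congr 1
    rw [e2, hlam]; field_simp
  have hlap : ∀ y, ‖y‖ < 1 / 2 → -lapl Z y = δ ^ 2 * (V (x + δ • y) * Real.exp (w y)) := by
    intro y hy
    have he : Z =ᶠ[nhds y] w := by
      filter_upwards [isOpen_ball.mem_nhds (show y ∈ ball (0:E2) (1/2) by simpa using hy)] with z hz
      exact hZw z (by simpa using hz)
    have hpd : ∀ j, pd j Z =ᶠ[nhds y] pd j w := fun j => by
      filter_upwards [he.eventuallyEq_nhds] with z hz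
      unfold pd; rw [hz.fderiv_eq]
    have e2 : lapl Z y = lapl w y := by
      have : ∀ j, pd j (pd j Z) y = pd j (pd j w) y := fun j => by
        show fderiv ℝ (pd j Z) y _ = fderiv ℝ (pd j w) y _
        rw [(hpd j).fderiv_eq]
      unfold lapl; rw [this, this]
    rw [e2, hw, lapl_affine, ← hpde _ (hmem y (by linarith))]; ring
  have hlap2 : ∀ y, ‖y‖ < 1 / 2 → -lapl Z y = V (x + δ • y) / lam ^ 2 * Real.exp (w y - u x) := by
    intro y hy
    rw [hlap y hy]
    calc _ = V (x + δ • y) * (δ ^ 2 * Real.exp (w y)) := by ring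
      _ = _ := by rw [hexp]; ring
  have hx0 : x + δ • (0:E2) = x := by simp
  have hZ0 : Z 0 = u x := by rw [hZw 0 (by simp), hw]; simp only [hx0]
  have hwm : ∀ y, ‖y‖ < 1 → w y ≤ u x := fun y hy => hmax _ (ball_subset_closedBall (hmem y hy))
  have hlb : ∀ y, ‖y‖ < 1 / 2 → 0 ≤ -lapl Z y ∧ -lapl Z y ≤ b / lam ^ 2 := by
    intro y hy
    obtain ⟨v0, v1⟩ := hVb _ (hmem y (by linarith))
    rw [hlap2 y hy]
    refine ⟨by positivity, ?_⟩
    have : Real.exp (w y - u x) ≤ 1 := Real.exp_le_one_iff.2 (by linarith [hwm y (by linarith)])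
    calc V (x + δ • y) / lam ^ 2 * Real.exp (w y - u x) ≤ b / lam ^ 2 * 1 := by gcongr
      _ = _ := by ring
  set G : E2 → ℝ := fun y => χ y * (-lapl Z y) with hG
  have hGc : Continuous G := hχ.continuous.mul (continuous_lapl hZc).neg
  have hGs : HasCompactSupport G := hχs.mul_right
  have hout : ∀ y, ¬ ‖y‖ < 1 / 2 → χ y = 0 := fun y hy => h0 y (by simp; simp at hy; linarith)
  have hG0 : ∀ y, 0 ≤ G y := by
    intro y
    by_cases hy : ‖y‖ < 1 / 2
    · exact mul_nonneg (hχ0 y) (hlb y hy).1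
    · simp only [hG, hout y hy, zero_mul]; exact le_refl _
  have hGle : ∀ y, ‖y‖ < 1 / 2 → G y ≤ -lapl Z y := fun y hy =>
    mul_le_of_le_one_left (hlb y hy).1 (hχ1 y)
  have hGI : ∫ y, G y ≤ ∫ y in ball x (δ / 2), V y * Real.exp (u y) := by
    rw [← integral_affine _ x hδ]
    have e1 : ∫ y, G y = ∫ y in ball (0:E2) (1/2), G y := by
      symm
      apply setIntegral_eq_integral_of_forall_compl_eq_zero
      intro y hy
      simp only [hG, hout y (by simpa using hy), zero_mul]
    rw [e1]
    have e2 : ∫ y in ball (0:E2) (1/2), δ ^ 2 * (V (x + δ • y) * Real.exp (u (x + δ • y))) =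
        ∫ y in ball (0:E2) (1/2), -lapl Z y :=
      setIntegral_congr_fun measurableSet_ball (fun y hy => (hlap y (by simpa using hy)).symm)
    rw [e2]
    refine setIntegral_mono_on (hGc.integrable_of_hasCompactSupport hGs).integrableOn ?_
      measurableSet_ball (fun y hy => hGle y (by simpa using hy))
    exact ((continuous_lapl hZc).neg.continuousOn.integrableOn_compact
      (isCompact_closedBall (0:E2) (1/2))).mono_set ball_subset_closedBall
  refine ⟨Z, G, ?_, hZw, hGI⟩
  refine ⟨hl, hrδ, hb, hC1, hZc.of_le (by norm_num), hGc, hGs, hG0, ?_, hGI.trans hM, ?_, ?_, ?_⟩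
  · intro y
    by_cases hy : ‖y‖ < 1 / 2
    · exact (hGle y hy).trans (hlb y hy).2
    · simp only [hG, hout y hy, zero_mul]; positivity
  · intro y hy
    have hy' : ‖y‖ < 1 / 4 := by simpa using hy
    have hy2 : ‖y‖ < 1 / 2 := by linarith
    have hχy : χ y = 1 := h1 y (by simp; linarith)
    simp only [hG, hχy, one_mul]
    rw [hlap2 y hy2, hZw y hy2, hZ0, ← sub_mul, ← sub_div, abs_mul, abs_div, abs_of_pos (Real.exp_pos _),
      abs_of_pos (by positivity : 0 < lam ^ 2)]
    have := hVh y (by linarith)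
    gcongr
  · intro y hy
    have hy' : ‖y‖ < 1 / 4 := by simpa using hy
    rw [hZw y (by linarith), hZ0]
    exact hwm y (by linarith)
  · refine hGR Z hZc (fun y ha hb => ?_)
    rw [hZw y (by linarith)]
    exact hn y ha hb

theorem stmt8
    (b A s C₀ : ℝ) (hs1 : 1/2 < s) (hs2 : s ≤ 1)
    (V u : ℕ → E2 → ℝ) (x_ : ℕ → E2) (δ r : ℕ → ℝ) (v : ℕ → E2 → ℝ)
    (hu : ∀ i, ContDiffOn ℝ 2 (u i) (closedBall (0:E2) 1))
    (hVb : ∀ i, ∀ x ∈ ball (0:E2) 1, 0 ≤ V i x ∧ V i x ≤ b)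
    (hVhol : ∀ i, ∀ x ∈ ball (0:E2) 1, ∀ y ∈ ball (0:E2) 1, |V i x - V i y| ≤ A * ‖x - y‖ ^ s)
    (hpde : ∀ i, ∀ x ∈ ball (0:E2) 1, -(lapl (u i) x) = V i x * Real.exp (u i x))
    (hbc : ∀ i, ∀ x ∈ sphere (0:E2) 1, u i x = 0)
    (hint : ∀ i, (∫ y in ball (0:E2) 1, Real.exp (u i y)) ≤ C₀)
    (hxmem : ∀ i, x_ i ∈ ball (0:E2) 1)
    (hmax : ∀ i, ∀ y ∈ closedBall (0:E2) 1, u i y ≤ u i (x_ i))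
    (hblow : Tendsto (fun i => u i (x_ i)) atTop atTop)
    (hδ : ∀ i, δ i = Metric.infDist (x_ i) (sphere (0:E2) 1))
    (hδ0 : Tendsto δ atTop (nhds 0))
    (hr : ∀ i, r i = Real.exp (-(u i (x_ i)) / 2))
    (hrδ : Tendsto (fun i => r i / δ i) atTop (nhds 0))
    (hmass : Tendsto (fun i => ∫ y in ball (x_ i) (δ i / 2), V i y * Real.exp (u i y)) atTop
      (nhds (8 * Real.pi)))
    (hbound : ∀ ε : ℝ, 0 < ε → ε < 1 → ∃ Cε : ℝ, ∀ i, ∀ y : E2, ‖y‖ = ε →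
      u i (x_ i + δ i • y) ≤ Cε)
    (hv : ∀ i θ, v i θ = u i (x_ i + r i • θ) - u i (x_ i)) :
    ∀ ε : ℝ, 0 < ε → ∀ ε' : ℝ, ε' ∈ Set.Ioo (0:ℝ) (1/4) →
      ∃ k > (0:ℝ), ∃ i₀ : ℕ, ∃ C > (0:ℝ), ∀ i ≥ i₀, ∀ θ : E2,
        k ≤ ‖θ‖ → ‖θ‖ ≤ δ i * ε' / r i →
        (-4 - ε) * Real.log ‖θ‖ - C ≤ v i θ ∧ v i θ ≤ (-4 + ε) * Real.log ‖θ‖ + C := by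
  intro ε hε ε' hε'
  have hpi := Real.pi_gt_three
  have hδp : ∀ i, 0 < δ i := fun i => by rw [hδ]; exact (infDist_facts (hxmem i)).1
  have hδx : ∀ i, δ i ≤ 1 - ‖x_ i‖ := fun i => by rw [hδ]; exact (infDist_facts (hxmem i)).2
  have hmem : ∀ i, ∀ y : E2, ‖y‖ < 1 → x_ i + δ i • y ∈ ball (0:E2) 1 := by
    intro i y hy
    rw [mem_ball_zero_iff]
    refine lt_of_le_of_lt (norm_add_le _ _) ?_
    rw [norm_smul, Real.norm_eq_abs, abs_of_pos (hδp i)]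
    have := mul_lt_mul_of_pos_left hy (hδp i)
    linarith [hδx i]
  have hb : 0 ≤ b := (hVb 0 0 (by simp)).1.trans (hVb 0 0 (by simp)).2
  have hpos : ∀ i, ∀ x ∈ closedBall (0:E2) 1, 0 ≤ u i x := fun i =>
    min_principle (hu i) (fun x hx => by
      have := hpde i x hx
      have h2 : 0 ≤ V i x * Real.exp (u i x) := mul_nonneg (hVb i x hx).1 (Real.exp_pos _).le
      linarith) (hbc i)
  obtain ⟨α, β, n, hα, hαβ, hβ, hn0, hn⟩ := baire_annulus (fun i => (hu i).continuousOn) hmem hbound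
  let χ : ContDiffBump (0:E2) := ⟨α, β, by linarith, hαβ⟩
  have hχ1 : ∀ y ∈ ball (0:E2) α, χ y = 1 := fun y hy =>
    χ.one_of_mem_closedBall (ball_subset_closedBall hy)
  have hχ0 : ∀ y, y ∉ closedBall (0:E2) β → χ y = 0 := fun y hy =>
    χ.zero_of_le_dist (by simp at hy; rw [dist_zero_right]; exact hy.le)
  obtain ⟨Cg, hCg, hgr⟩ := grad_rep (χ := χ) χ.contDiff χ.hasCompactSupport hα (by linarith) hχ1 hχ0
  set C1 := Cg * n with hC1
  have hC1p : 0 ≤ C1 := by positivity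
  set τ : ℕ → ℝ := fun i => |A| * δ i ^ s with hτ
  have hsp : 0 < s := by linarith
  have hτ0 : Tendsto τ atTop (nhds 0) := by
    have h1 : Tendsto (fun i => δ i ^ s) atTop (nhds ((0:ℝ) ^ s)) :=
      hδ0.rpow_const (Or.inr hsp.le)
    rw [Real.zero_rpow hsp.ne'] at h1
    simpa using h1.const_mul |A|
  have hVh : ∀ i, ∀ y : E2, ‖y‖ < 1 → |V i (x_ i + δ i • y) - V i (x_ i)| ≤ τ i := by
    intro i y hy
    refine (hVhol i _ (hmem i y hy) _ (hxmem i)).trans ?_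
    rw [add_sub_cancel_left, norm_smul, Real.norm_eq_abs, abs_of_pos (hδp i)]
    have h1 : (δ i * ‖y‖) ^ s ≤ δ i ^ s := by
      refine Real.rpow_le_rpow (mul_nonneg (hδp i).le (norm_nonneg y)) ?_ hsp.le
      exact mul_le_of_le_one_right (hδp i).le hy.le
    have h2 : 0 ≤ (δ i * ‖y‖) ^ s := Real.rpow_nonneg (mul_nonneg (hδp i).le (norm_nonneg y)) _
    exact mul_le_mul (le_abs_self A) h1 h2 (abs_nonneg A)
  -- lower bound for V at the centre
  set K := |C₀| + 1 with hK
  have hKp : 0 < K := by positivity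
  set c := 2 * Real.pi / K with hc
  have hcp : 0 < c := by positivity
  have hVlow : ∀ᶠ i in atTop, c ≤ V i (x_ i) := by
    have e1 : ∀ᶠ i in atTop, 4 * Real.pi < ∫ y in ball (x_ i) (δ i / 2), V i y * Real.exp (u i y) :=
      hmass.eventually (lt_mem_nhds (by linarith))
    have e2 : ∀ᶠ i in atTop, τ i < c := hτ0.eventually (gt_mem_nhds hcp)
    filter_upwards [e1, e2] with i h1 h2
    have hV0 := (hVb i _ (hxmem i)).1
    have hτi : 0 ≤ τ i := mul_nonneg (abs_nonneg A) (Real.rpow_nonneg (hδp i).le _)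
    have hsub : ball (x_ i) (δ i / 2) ⊆ ball (0:E2) 1 := by
      intro y hy
      rw [mem_ball, dist_eq_norm] at hy
      rw [mem_ball_zero_iff]
      have := norm_add_le (y - x_ i) (x_ i)
      rw [sub_add_cancel] at this
      linarith [hδx i, hδp i]
    have hei : IntegrableOn (fun y => Real.exp (u i y)) (ball (0:E2) 1) :=
      ((Real.continuous_exp.comp_continuousOn (hu i).continuousOn).integrableOn_compact
        (isCompact_closedBall (0:E2) 1)).mono_set ball_subset_closedBall
    have h3 : ∫ y in ball (x_ i) (δ i / 2), V i y * Real.exp (u i y) ≤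
        ∫ y in ball (x_ i) (δ i / 2), (V i (x_ i) + τ i) * Real.exp (u i y) := by
      refine integral_mono_of_nonneg ?_ ((hei.mono_set hsub).const_mul _) ?_
      · filter_upwards [ae_restrict_mem measurableSet_ball] with y hy
        exact mul_nonneg (hVb i y (hsub hy)).1 (Real.exp_pos _).le
      · filter_upwards [ae_restrict_mem measurableSet_ball] with y hy
        refine mul_le_mul_of_nonneg_right ?_ (Real.exp_pos _).le
        have hy' : ‖y - x_ i‖ < δ i / 2 := by rwa [mem_ball, dist_eq_norm] at hy
        have hz : ‖(δ i)⁻¹ • (y - x_ i)‖ < 1 := by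
          rw [norm_smul, norm_inv, Real.norm_eq_abs, abs_of_pos (hδp i), inv_mul_lt_iff₀ (hδp i)]
          linarith [hδp i]
        have := hVh i _ hz
        rw [smul_smul, mul_inv_cancel₀ (hδp i).ne', one_smul, add_sub_cancel] at this
        linarith [(abs_le.1 this).2]
    have h4 : ∫ y in ball (x_ i) (δ i / 2), Real.exp (u i y) ≤ K := by
      have h5 : ∫ y in ball (x_ i) (δ i / 2), Real.exp (u i y) ≤ ∫ y in ball (0:E2) 1, Real.exp (u i y) :=
        setIntegral_mono_set hei (Eventually.of_forall fun y => (Real.exp_pos _).le) hsub.eventuallyLE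
      have := hint i
      have := le_abs_self C₀
      linarith
    rw [integral_const_mul] at h3
    have h6 : (V i (x_ i) + τ i) * ∫ y in ball (x_ i) (δ i / 2), Real.exp (u i y) ≤ (V i (x_ i) + τ i) * K := by
      gcongr
    have h7 : 2 * c * K = 4 * Real.pi := by rw [hc]; field_simp; ring
    have h8 : 2 * c * K < (V i (x_ i) + τ i) * K := by linarith
    have h9 := lt_of_mul_lt_mul_right h8 hKp.le
    linarith
  set η := min ε 1 with hη
  have hηp : 0 < η := lt_min hε one_pos
  set M := 8 * Real.pi + 1 with hMdef
  have hM0 : 0 ≤ M := by positivity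
  obtain ⟨R, hR, ρ, hρ, hconc⟩ := concentration b C1 M c hb hC1p hM0 hcp η hηp
  have e1 : ∀ᶠ i in atTop, ∫ y in ball (x_ i) (δ i / 2), V i y * Real.exp (u i y) < 8 * Real.pi + η :=
    hmass.eventually (gt_mem_nhds (by linarith))
  have e2 : ∀ᶠ i in atTop, τ i < ρ := hτ0.eventually (gt_mem_nhds hρ)
  have e3 : ∀ᶠ i in atTop, r i / δ i < ρ := hrδ.eventually (gt_mem_nhds hρ)
  have e4 : ∀ᶠ i in atTop, r i / δ i < 1 := hrδ.eventually (gt_mem_nhds one_pos)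
  obtain ⟨i₀, hi₀⟩ := eventually_atTop.1 (e1.and (e2.and (e3.and (e4.and hVlow))))
  set KK := C1 + M * (Real.log 2 + Real.log R) + 2 * (2 * Real.pi * b + M) with hKK
  have hKK0 : 0 ≤ KK := by
    have := Real.log_nonneg one_le_two
    have := Real.log_nonneg hR
    positivity
  refine ⟨2 * R, by linarith, i₀, KK + 1, by linarith, fun i hi θ hθ1 hθ2 => ?_⟩
  obtain ⟨f1, f2, f3, f4, f5⟩ := hi₀ i hi
  have hδi := hδp i
  have hri : 0 < r i := by rw [hr]; exact Real.exp_pos _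
  obtain ⟨Z, G, hB, hZ, hGI⟩ := mk_bub (χ := χ) (α := α) (β := β) (n := n) (C1 := C1)
    χ.contDiff χ.hasCompactSupport hα hβ hχ1 hχ0
    (fun y => χ.nonneg) (fun y => χ.le_one) hC1p (fun Z hZ hZn => hgr n hn0 Z hZ hZn) (M := M) hδi hb (hu i)
    (hmem i) (hVb i) (hVh i) (hpde i) (hmax i) (hr i) f4.le
    (fun y h1 h2 => by
      rw [abs_of_nonneg (hpos i _ (ball_subset_closedBall (hmem i y (by linarith))))]
      exact hn i y h1 h2)
    (by linarith [min_le_right ε 1])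
  have hlow := hconc _ _ _ Z G hB f5 f3 f2
  set lam := r i / δ i with hlam
  have hl : 0 < lam := by positivity
  have hnx : ‖lam • θ‖ = lam * ‖θ‖ := by rw [norm_smul, Real.norm_eq_abs, abs_of_pos hl]
  have hle : lam * ‖θ‖ ≤ ε' := by
    rw [le_div_iff₀ hri] at hθ2
    rw [hlam, div_mul_eq_mul_div, div_le_iff₀ hδi]
    linarith
  have hx4 : ‖lam • θ‖ < 1 / 4 := by rw [hnx]; linarith [hε'.2]
  have hest := hB.main_est hηp.le hR (hGI.trans f1.le) hlow (x := lam • θ) (by simpa using hx4)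
    (by rw [hnx]; nlinarith)
  have hdiv : ‖lam • θ‖ / lam = ‖θ‖ := by rw [hnx]; field_simp
  rw [hdiv, hZ _ (by linarith), hZ 0 (by simp)] at hest
  have hpt : δ i • lam • θ = r i • θ := by
    rw [smul_smul, hlam, mul_div_cancel₀ _ hδi.ne']
  rw [hpt, smul_zero, add_zero, ← hv, ← hKK] at hest
  have hlog : 0 ≤ Real.log ‖θ‖ := Real.log_nonneg (by linarith)
  have hηε : η * Real.log ‖θ‖ ≤ ε * Real.log ‖θ‖ := by
    gcongr
    exact min_le_left _ _
  obtain ⟨g1, g2⟩ := abs_le.1 hest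
  constructor <;> linarith
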